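/- arXiv:1001.0811 — 3 statements merged into one kernel-verified Lean document; each statement's English description precedes it below -/
import Mathlib

section
/- Let n ≥ 3 and let λ be a partition of n. Over any field, J(n−1,1) commutes with some conjugate of J(λ) if and only if one of the following holds: (i) λ has a part of size 1, and the partition λ⁻ of n−1 obtained by removing one such part satisfies: its largest part minus its smallest part is at most 1; (ii) n is even and all parts of λ have size 2; (iii) λ has a part of size 3, all its other parts have size 1 or 2, and it has at least one part of size 1; (iv) n = 3 and λ = (3). -/
open Polynomial Matrix

/-- Two square matrices over a commutative ring are *similar* if they are
conjugate by an invertible matrix. -/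
def SimilarMat {m : Type*} [Fintype m] [DecidableEq m] {K : Type*} [CommRing K]
    (A B : Matrix m m K) : Prop :=
  ∃ P : (Matrix m m K)ˣ, B = (↑P : Matrix m m K) * A * (↑P⁻¹ : Matrix m m K)

/-- The nilpotent Jordan block of size `p` (eigenvalue `0`). -/
def jordanBlock (K : Type*) [Zero K] [One K] (p : ℕ) : Matrix (Fin p) (Fin p) K :=
  Matrix.of fun i j => if (i : ℕ) + 1 = (j : ℕ) then 1 else 0

/-- `M` is a nilpotent matrix whose Jordan block sizes are the parts of the
partition `mu`; that is, `M` is similar to the direct sum of the nilpotent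
Jordan blocks whose sizes are the parts of `mu`. -/
def HasJordanPartition {K : Type*} [Field K] {n : ℕ}
    (M : Matrix (Fin n) (Fin n) K) (mu : Nat.Partition n) : Prop :=
  ∃ L : List ℕ, (↑L : Multiset ℕ) = mu.parts ∧
    ∃ e : ((i : Fin L.length) × Fin (L.get i)) ≃ Fin n,
      SimilarMat (Matrix.reindex e e (Matrix.blockDiagonal' fun i => jordanBlock K (L.get i))) M
/-- Two families indexed by finite types with the same multiset of values differ by a
bijection of the index types. -/
theorem exists_equiv_of_map_univ_eq {S T α : Type*} [Fintype S] [Fintype T]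
    (f : S → α) (g : T → α)
    (h : (Finset.univ : Finset S).val.map f = (Finset.univ : Finset T).val.map g) :
    ∃ e : S ≃ T, ∀ s, g (e s) = f s := by
  classical
  have hcard : ∀ a, Fintype.card {s // f s = a} = Fintype.card {t // g t = a} := by
    intro a
    have := congrArg (Multiset.count a) h
    rw [Multiset.count_map, Multiset.count_map] at this
    rw [Fintype.card_subtype, Fintype.card_subtype, Finset.card_def, Finset.card_def,
      Finset.filter_val, Finset.filter_val]
    simpa only [eq_comm] using this
  let φ : ∀ a, {s // f s = a} ≃ {t // g t = a} := fun a => Fintype.equivOfCardEq (hcard a)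
  refine ⟨(Equiv.sigmaFiberEquiv f).symm.trans
    ((Equiv.sigmaCongrRight φ).trans (Equiv.sigmaFiberEquiv g)), fun s => ?_⟩
  exact (φ (f s) ⟨s, rfl⟩).2

/-- The vectors `w s` generate Jordan chains of `x` of lengths `l s` which together span. -/
def JordanGenerators {K V S : Type*} [Field K] [AddCommGroup V] [Module K V]
    (x : Module.End K V) (l : S → ℕ) (w : S → V) : Prop :=
  (∀ s, (x ^ l s) (w s) = 0) ∧
    ⊤ ≤ Submodule.span K (Set.range fun a : (s : S) × Fin (l s) => (x ^ (a.2 : ℕ)) (w a.1))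

theorem jordanSum_mulVec_single {K : Type*} [Field K] {n : ℕ} {T : Type*} [Fintype T]
    [DecidableEq T] {l : T → ℕ} (e : ((t : T) × Fin (l t)) ≃ Fin n) (t : T) (k : Fin (l t)) :
    Matrix.reindex e e (Matrix.blockDiagonal' fun t => jordanBlock K (l t)) *ᵥ
        Pi.single (e ⟨t, k⟩) 1 =
      if 0 < (k : ℕ) then Pi.single (e ⟨t, ⟨k - 1, by omega⟩⟩) 1 else 0 := by
  ext i
  obtain ⟨⟨t', k'⟩, rfl⟩ := e.surjective i
  rw [Matrix.mulVec_single_one]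
  by_cases ht : t' = t
  · subst ht
    simp only [Matrix.col_apply, Matrix.reindex_apply, Matrix.submatrix_apply,
      Equiv.symm_apply_apply, Matrix.blockDiagonal'_apply_eq, jordanBlock, Matrix.of_apply]
    split_ifs with h1 h2 h2
    · rw [show k' = ⟨k - 1, by omega⟩ from Fin.ext (by simp; omega)]
      simp
    · omega
    · rw [Pi.single_eq_of_ne]
      simp only [ne_eq, EmbeddingLike.apply_eq_iff_eq, Sigma.mk.injEq, heq_eq_eq, true_and]
      intro h
      exact h1 (by rw [h]; simp; omega)
    · rfl
  · simp only [Matrix.col_apply, Matrix.reindex_apply, Matrix.submatrix_apply,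
      Equiv.symm_apply_apply]
    rw [Matrix.blockDiagonal'_apply_ne _ _ _ ht]
    split_ifs with h2
    · rw [Pi.single_eq_of_ne]
      simp [ht]
    · rfl

theorem exists_jordanGenerators_of_similarMat {K : Type*} [Field K] {n : ℕ} {T : Type*} [Fintype T]
    [DecidableEq T] {l : T → ℕ} (e : ((t : T) × Fin (l t)) ≃ Fin n) {M : Matrix (Fin n) (Fin n) K}
    (h : SimilarMat (Matrix.reindex e e (Matrix.blockDiagonal' fun t => jordanBlock K (l t))) M) :
    ∃ w, JordanGenerators (Matrix.toLin' M) l w := by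
  obtain ⟨P, rfl⟩ := h
  set R := Matrix.reindex e e (Matrix.blockDiagonal' fun t => jordanBlock K (l t))
  let v : T → ℕ → Fin n → K := fun t k =>
    if h : k < l t then
      (P : Matrix (Fin n) (Fin n) K) *ᵥ Pi.single (e ⟨t, ⟨l t - 1 - k, by omega⟩⟩) 1
    else 0
  have hstep : ∀ t k, Matrix.toLin' (P.val * R * P⁻¹.val) (v t k)
      = v t (k + 1) := by
    intro t k
    simp only [v]
    split_ifs with h1 h2
    · rw [Matrix.toLin'_apply, Matrix.mulVec_mulVec, mul_assoc, Units.inv_mul, mul_one,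
        ← Matrix.mulVec_mulVec, jordanSum_mulVec_single, if_pos (by simp; omega)]
      rfl
    · rw [Matrix.toLin'_apply, Matrix.mulVec_mulVec, mul_assoc, Units.inv_mul, mul_one,
        ← Matrix.mulVec_mulVec, jordanSum_mulVec_single, if_neg (by simp; omega),
        Matrix.mulVec_zero]
    · omega
    · simp
  have hpow : ∀ t k, (Matrix.toLin' (P.val * R * P⁻¹.val) ^ k) (v t 0)
      = v t k := by
    intro t k
    induction k with
    | zero => simp
    | succ k ih => rw [pow_succ', Module.End.mul_apply, ih, hstep]
  refine ⟨fun t => v t 0, fun t => ?_, fun z _ => ?_⟩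
  · rw [hpow]
    simp [v]
  · have hz : z = ∑ j, (P⁻¹.val *ᵥ z) j • (P.val *ᵥ Pi.single j 1) := by
      conv_lhs => rw [← Matrix.one_mulVec z, ← P.mul_inv, ← Matrix.mulVec_mulVec,
        Matrix.mulVec_eq_sum]
      simp only [Matrix.mulVec_single_one, op_smul_eq_smul]
      rfl
    rw [hz]
    refine Submodule.sum_mem _ fun j _ => Submodule.smul_mem _ _ (Submodule.subset_span ?_)
    obtain ⟨⟨t, k⟩, rfl⟩ := e.surjective j
    refine ⟨⟨t, ⟨l t - 1 - k, by omega⟩⟩, ?_⟩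
    simp only [hpow]
    simp only [v]
    rw [dif_pos (by omega)]
    congr 5
    omega

theorem similarMat_of_jordanGenerators {K : Type*} [Field K] {n : ℕ} {T : Type*} [Fintype T]
    [DecidableEq T] {l : T → ℕ} (e : ((t : T) × Fin (l t)) ≃ Fin n) {M : Matrix (Fin n) (Fin n) K}
    {w : T → Fin n → K} (h : JordanGenerators (Matrix.toLin' M) l w) :
    SimilarMat (Matrix.reindex e e (Matrix.blockDiagonal' fun t => jordanBlock K (l t))) M := by
  set R := Matrix.reindex e e (Matrix.blockDiagonal' fun t => jordanBlock K (l t)) with hR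
  let b : (t : T) × Fin (l t) → Fin n → K := fun a =>
    (Matrix.toLin' M ^ (l a.1 - 1 - a.2)) (w a.1)
  have hb : LinearIndependent K b := by
    apply linearIndependent_of_top_le_span_of_card_eq_finrank
    · refine h.2.trans (Submodule.span_mono ?_)
      rintro _ ⟨⟨t, k⟩, rfl⟩
      refine ⟨⟨t, ⟨l t - 1 - k, by omega⟩⟩, ?_⟩
      simp only [b]
      congr 2
      omega
    · rw [Fintype.card_congr e]
      simp
  let P : Matrix (Fin n) (Fin n) K := Matrix.of fun i j => b (e.symm j) i
  have hP : IsUnit P := by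
    rw [← Matrix.linearIndependent_cols_iff_isUnit]
    exact hb.comp _ e.symm.injective
  have hcol : ∀ a, P *ᵥ Pi.single (e a) 1 = b a := by
    intro a
    rw [Matrix.mulVec_single_one]
    ext i
    simp [P]
  have hMP : M * P = P * R := by
    apply Matrix.toLin'.injective
    refine (Pi.basisFun K (Fin n)).ext fun j => ?_
    obtain ⟨⟨t, k⟩, rfl⟩ := e.surjective j
    rw [Pi.basisFun_apply, Matrix.toLin'_apply, Matrix.toLin'_apply, ← Matrix.mulVec_mulVec,
      ← Matrix.mulVec_mulVec, hcol, hR, jordanSum_mulVec_single, ← Matrix.toLin'_apply]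
    simp only [b]
    rw [← Module.End.mul_apply, ← pow_succ']
    split_ifs with hk
    · rw [hcol]
      simp only [b]
      congr 2
      omega
    · rw [Matrix.mulVec_zero, show l t - 1 - k + 1 = l t by omega, h.1]
  obtain ⟨Q, hQ⟩ := hP
  refine ⟨Q, ?_⟩
  rw [hQ, ← hMP, ← hQ, mul_assoc, Units.mul_inv, mul_one]

theorem JordanGenerators.reindex {K V S T : Type*} [Field K] [AddCommGroup V] [Module K V]
    {x : Module.End K V} {l : S → ℕ} {w : S → V} (h : JordanGenerators x l w) {l' : T → ℕ}
    (e : T ≃ S) (he : ∀ t, l (e t) = l' t) :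
    JordanGenerators x l' (w ∘ e) := by
  refine ⟨fun t => ?_, h.2.trans (Submodule.span_mono ?_)⟩
  · rw [← he]
    exact h.1 _
  · rintro _ ⟨⟨s, k⟩, rfl⟩
    obtain ⟨t, rfl⟩ := e.surjective s
    exact ⟨⟨t, ⟨k, by rw [← he]; exact k.2⟩⟩, rfl⟩

theorem map_univ_get {α : Type*} (L : List α) :
    (Finset.univ : Finset (Fin L.length)).val.map L.get = ↑L := by
  rw [Fin.univ_val_map, List.ofFn_get]

theorem card_sigma_get {n : ℕ} {mu : Nat.Partition n} {L : List ℕ}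
    (hL : (↑L : Multiset ℕ) = mu.parts) :
    Fintype.card ((i : Fin L.length) × Fin (L.get i)) = Fintype.card (Fin n) := by
  have : ∑ i, L.get i = n := by
    rw [← mu.parts_sum, ← hL, ← map_univ_get L]
    rfl
  simpa using this

theorem hasJordanPartition_iff {K : Type*} [Field K] {n : ℕ} {M : Matrix (Fin n) (Fin n) K}
    {mu : Nat.Partition n} {S : Type*} [Fintype S] (l : S → ℕ)
    (hl : (Finset.univ : Finset S).val.map l = mu.parts) :
    HasJordanPartition M mu ↔ ∃ w, JordanGenerators (Matrix.toLin' M) l w := by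
  constructor
  · rintro ⟨L, hL, e, h⟩
    obtain ⟨w, hw⟩ := exists_jordanGenerators_of_similarMat e h
    obtain ⟨σ, hσ⟩ := exists_equiv_of_map_univ_eq l L.get (by rw [hl, map_univ_get, hL])
    exact ⟨_, hw.reindex σ hσ⟩
  · rintro ⟨w, hw⟩
    obtain ⟨L, hL⟩ := Quot.exists_rep mu.parts
    replace hL : (↑L : Multiset ℕ) = mu.parts := hL
    obtain ⟨σ, hσ⟩ := exists_equiv_of_map_univ_eq L.get l (by rw [hl, map_univ_get, hL])
    let e := Fintype.equivOfCardEq (card_sigma_get hL)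
    exact ⟨L, hL, e, similarMat_of_jordanGenerators e (hw.reindex σ hσ)⟩

/-- The rank of `x ^ j` in terms of the lengths of the Jordan chains of `x`. -/
theorem JordanGenerators.finrank_range_pow {K V S : Type*} [Field K] [AddCommGroup V] [Module K V]
    [Fintype S] {x : Module.End K V} {l : S → ℕ} {w : S → V} (h : JordanGenerators x l w)
    (hdim : ∑ s, l s = Module.finrank K V) (j : ℕ) :
    Module.finrank K (LinearMap.range (x ^ j)) = ∑ s, (l s - j) := by
  have hLI := linearIndependent_of_top_le_span_of_card_eq_finrank h.2 (by simpa using hdim)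
  let ι : (s : S) × Fin (l s - j) → (s : S) × Fin (l s) := fun a => ⟨a.1, ⟨a.2 + j, by omega⟩⟩
  have hι : Function.Injective ι := by
    rintro ⟨s, k⟩ ⟨s', k'⟩ hs
    simp only [ι, Sigma.mk.injEq] at hs
    obtain ⟨rfl, hs⟩ := hs
    simp only [heq_eq_eq, Fin.mk.injEq] at hs
    congr
    ext
    omega
  have hrange : LinearMap.range (x ^ j) = Submodule.span K
      (Set.range ((fun a : (s : S) × Fin (l s) => (x ^ (a.2 : ℕ)) (w a.1)) ∘ ι)) := by
    apply le_antisymm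
    · rw [LinearMap.range_eq_map, Submodule.map_le_iff_le_comap]
      refine h.2.trans (Submodule.span_le.2 ?_)
      rintro _ ⟨⟨s, k⟩, rfl⟩
      simp only [Submodule.comap_coe, Set.mem_preimage, SetLike.mem_coe]
      rw [← Module.End.mul_apply, ← pow_add]
      by_cases hk : k < l s - j
      · refine Submodule.subset_span ⟨⟨s, ⟨k, hk⟩⟩, ?_⟩
        simp [ι, add_comm]
      · rw [show j + (k : ℕ) = (j + k - l s) + l s by omega, pow_add, Module.End.mul_apply, h.1,
          map_zero]
        exact zero_mem _
    · rw [Submodule.span_le]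
      rintro _ ⟨⟨s, k⟩, rfl⟩
      refine ⟨(x ^ (k : ℕ)) (w s), ?_⟩
      rw [← Module.End.mul_apply, ← pow_add]
      simp [ι, add_comm]
  rw [hrange, finrank_span_eq_card (hLI.comp _ hι)]
  simp

theorem HasJordanPartition.finrank_range_pow {K : Type*} [Field K] {n : ℕ}
    {M : Matrix (Fin n) (Fin n) K} {mu : Nat.Partition n} (h : HasJordanPartition M mu) (j : ℕ) :
    Module.finrank K (LinearMap.range (Matrix.toLin' M ^ j)) =
      (mu.parts.map fun p => p - j).sum := by
  obtain ⟨L, hL⟩ := Quot.exists_rep mu.parts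
  replace hL : (↑L : Multiset ℕ) = mu.parts := hL
  have hmap := map_univ_get L
  rw [hL] at hmap
  obtain ⟨w, hw⟩ := (hasJordanPartition_iff L.get hmap).1 h
  rw [hw.finrank_range_pow, ← hmap, Multiset.map_map]
  · rfl
  · rw [Module.finrank_fin_fun, ← mu.parts_sum, ← hmap]
    rfl
/-- The vectors `u 0, …, u (m - 1), f` form a Jordan basis of `x`, with chains
`u 0 ↦ u 1 ↦ ⋯ ↦ u (m - 1) ↦ 0` and `f ↦ 0`, and with coordinate functionals `φ i` and `ψ`. -/
structure HookBasis {K V : Type*} [Field K] [AddCommGroup V] [Module K V] (x : Module.End K V)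
    (m : ℕ) (u : ℕ → V) (f : V) (φ : ℕ → V →ₗ[K] K) (ψ : V →ₗ[K] K) : Prop where
  x_u : ∀ i, x (u i) = u (i + 1)
  x_f : x f = 0
  u_eq_zero : ∀ i, m ≤ i → u i = 0
  φ_u : ∀ i j, i < m → φ i (u j) = if j = i then 1 else 0
  φ_f : ∀ i, φ i f = 0
  ψ_u : ∀ i, ψ (u i) = 0
  ψ_f : ψ f = 1
  expand : ∀ v, v = ∑ i ∈ Finset.range m, φ i v • u i + ψ v • f

theorem exists_hookBasis {K : Type*} [Field K] {n m : ℕ} (hn : n = m + 1)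
    {X : Matrix (Fin n) (Fin n) K} {ρ : Nat.Partition n} (hρ : ρ.parts = {m, 1})
    (hX : HasJordanPartition X ρ) :
    ∃ u f φ ψ, HookBasis (Matrix.toLin' X) m u f φ ψ := by
  obtain ⟨w, hw0, hw⟩ := (hasJordanPartition_iff ![m, 1] (by rw [hρ]; rfl)).1 hX
  let b := basisOfTopLeSpanOfCardEqFinrank _ hw (by simp [hn])
  have hb : ∀ s k, b ⟨s, k⟩ = (Matrix.toLin' X ^ (k : ℕ)) (w s) := fun s k => by simp [b]
  set x := Matrix.toLin' X
  have hw00 : (x ^ m) (w 0) = 0 := hw0 0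
  have hw01 : x (w 1) = 0 := by simpa using hw0 1
  have hu : ∀ i, m ≤ i → (x ^ i) (w 0) = 0 := fun i hi => by
    rw [← Nat.sub_add_cancel hi, pow_add, Module.End.mul_apply, hw00, map_zero]
  have hb0 : ∀ i (hi : i < m), b ⟨0, ⟨i, hi⟩⟩ = (x ^ i) (w 0) := fun i hi => hb 0 ⟨i, hi⟩
  have hb1 : b ⟨1, ⟨0, Nat.one_pos⟩⟩ = w 1 := by rw [hb]; rfl
  refine ⟨fun i => (x ^ i) (w 0), w 1,
    fun i => if h : i < m then b.coord ⟨0, ⟨i, h⟩⟩ else 0, b.coord ⟨1, ⟨0, Nat.one_pos⟩⟩,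
    fun i => ?_, hw01, hu, fun i j hi => ?_, fun i => ?_, fun i => ?_, ?_, fun v => ?_⟩
  · rw [pow_succ', Module.End.mul_apply]
  · rw [dif_pos hi]
    by_cases hj : j < m
    · rw [← hb0 j hj, Module.Basis.coord_apply, Module.Basis.repr_self, Finsupp.single_apply]
      by_cases hij : j = i
      · subst hij
        simp
      · rw [if_neg hij, if_neg]
        exact fun h => hij (congrArg (fun a => (a.2 : ℕ)) h)
    · rw [hu j (by omega), map_zero, if_neg (by omega)]
  · split_ifs with hi
    · rw [← hb1, Module.Basis.coord_apply, Module.Basis.repr_self, Finsupp.single_apply,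
        if_neg fun h => one_ne_zero (congrArg Sigma.fst h)]
    · rfl
  · by_cases hi : i < m
    · rw [← hb0 i hi, Module.Basis.coord_apply, Module.Basis.repr_self, Finsupp.single_apply,
        if_neg fun h => zero_ne_one (congrArg Sigma.fst h)]
    · rw [hu i (by omega), map_zero]
  · rw [← hb1, Module.Basis.coord_apply, Module.Basis.repr_self, Finsupp.single_eq_same]
  · conv_lhs => rw [← b.sum_repr v, Fintype.sum_sigma, Fin.sum_univ_two]
    rw [← Fin.sum_univ_eq_sum_range
      (fun i => (if h : i < m then b.coord ⟨0, ⟨i, h⟩⟩ else 0) v • (x ^ i) (w 0)) m]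
    have key : ∀ i : Fin m, b.repr v ⟨0, i⟩ • b ⟨0, i⟩ =
        (if h : (i : ℕ) < m then b.coord ⟨0, ⟨i, h⟩⟩ else 0) v • (x ^ (i : ℕ)) (w 0) := fun i => by
      rw [dif_pos i.2]
      exact congrArg _ (hb0 i i.2)
    congr 1
    · exact Finset.sum_congr rfl fun i _ => key i
    · refine (Fin.sum_univ_one (fun i : Fin 1 => b.repr v ⟨1, i⟩ • b ⟨1, i⟩)).trans ?_
      exact congrArg _ hb1

namespace HookBasis

variable {K V : Type*} [Field K] [AddCommGroup V] [Module K V] {x : Module.End K V} {m : ℕ}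
  {u : ℕ → V} {f : V} {φ : ℕ → V →ₗ[K] K} {ψ : V →ₗ[K] K}

theorem end_ext (h : HookBasis x m u f φ ψ) {y z : Module.End K V}
    (hu : ∀ i < m, y (u i) = z (u i)) (hf : y f = z f) : y = z := by
  ext v
  rw [h.expand v]
  simp only [map_add, map_sum, map_smul, hf]
  congr 1
  exact Finset.sum_congr rfl fun i hi => by rw [hu i (Finset.mem_range.1 hi)]

theorem eq_top (h : HookBasis x m u f φ ψ) {W : Submodule K V} (hu : ∀ i < m, u i ∈ W)
    (hf : f ∈ W) : ⊤ ≤ W := by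
  intro v _
  rw [h.expand v]
  exact W.add_mem (W.sum_mem fun i hi => W.smul_mem _ (hu i (Finset.mem_range.1 hi)))
    (W.smul_mem _ hf)

theorem pow_u (h : HookBasis x m u f φ ψ) (j i : ℕ) : (x ^ j) (u i) = u (i + j) := by
  induction j with
  | zero => rfl
  | succ j ih => rw [pow_succ', Module.End.mul_apply, ih, h.x_u, add_assoc]

theorem pow_f (h : HookBasis x m u f φ ψ) {j : ℕ} (hj : 1 ≤ j) : (x ^ j) f = 0 := by
  rw [← Nat.sub_add_cancel hj, pow_succ, Module.End.mul_apply, h.x_f, map_zero]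

end HookBasis

/-- The operator `u 0 ↦ a • f`, `f ↦ b • u (m - 1)`, vanishing on the other basis vectors of a
`HookBasis`. -/
noncomputable def hookSwap {K V : Type*} [Field K] [AddCommGroup V] [Module K V] (m : ℕ)
    (u : ℕ → V) (f : V) (φ : ℕ → V →ₗ[K] K) (ψ : V →ₗ[K] K) (a b : K) : Module.End K V :=
  a • (φ 0).smulRight f + b • ψ.smulRight (u (m - 1))

namespace HookBasis

variable {K V : Type*} [Field K] [AddCommGroup V] [Module K V] {x : Module.End K V} {m : ℕ}
  {u : ℕ → V} {f : V} {φ : ℕ → V →ₗ[K] K} {ψ : V →ₗ[K] K}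

theorem hookSwap_u (h : HookBasis x m u f φ ψ) (hm : 2 ≤ m) (a b : K) (i : ℕ) :
    hookSwap m u f φ ψ a b (u i) = if i = 0 then a • f else 0 := by
  simp [hookSwap, h.φ_u 0 i (by omega), h.ψ_u]

theorem hookSwap_f (h : HookBasis x m u f φ ψ) (a b : K) :
    hookSwap m u f φ ψ a b f = b • u (m - 1) := by
  simp [hookSwap, h.φ_f, h.ψ_f]

theorem hookSwap_mul (h : HookBasis x m u f φ ψ) (hm : 2 ≤ m) (a b : K) :
    hookSwap m u f φ ψ a b * x = 0 := by
  apply h.end_ext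
  · intro i _
    simp [h.x_u, h.hookSwap_u hm]
  · simp [h.x_f]

theorem mul_hookSwap (h : HookBasis x m u f φ ψ) (hm : 2 ≤ m) (a b : K) :
    x * hookSwap m u f φ ψ a b = 0 := by
  apply h.end_ext
  · intro i _
    rw [Module.End.mul_apply, h.hookSwap_u hm]
    split_ifs <;> simp [h.x_f]
  · rw [Module.End.mul_apply, h.hookSwap_f, map_smul, h.x_u, h.u_eq_zero _ (by omega)]
    simp

theorem hookSwap_sq (h : HookBasis x m u f φ ψ) (hm : 2 ≤ m) (a b : K) :
    hookSwap m u f φ ψ a b ^ 2 = (a * b) • x ^ (m - 1) := by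
  rw [pow_two]
  apply h.end_ext
  · intro i _
    rw [Module.End.mul_apply, h.hookSwap_u hm, LinearMap.smul_apply, h.pow_u]
    split_ifs with hi
    · rw [map_smul, h.hookSwap_f, hi, zero_add, smul_smul]
    · rw [h.u_eq_zero _ (by omega)]
      simp
  · rw [Module.End.mul_apply, h.hookSwap_f, map_smul, h.hookSwap_u hm, if_neg (by omega),
      LinearMap.smul_apply, h.pow_f (by omega)]
    simp

theorem hookSwap_pow (h : HookBasis x m u f φ ψ) (hm : 2 ≤ m) (a b : K) {j : ℕ} (hj : 3 ≤ j) :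
    hookSwap m u f φ ψ a b ^ j = 0 := by
  rw [← Nat.sub_add_cancel (show 2 ≤ j by omega), pow_add, h.hookSwap_sq hm,
    ← Nat.sub_add_cancel (show 1 ≤ j - 2 by omega), ← Nat.sub_add_cancel (show 1 ≤ m - 1 by omega),
    pow_succ (hookSwap m u f φ ψ a b), pow_succ' x, mul_smul_comm, mul_assoc, ← mul_assoc _ x,
    h.hookSwap_mul hm]
  simp

end HookBasis
theorem map_univ_sumElim {S T α : Type*} [Fintype S] [Fintype T] (f : S → α) (g : T → α) :
    (Finset.univ : Finset (S ⊕ T)).val.map (Sum.elim f g) =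
      (Finset.univ : Finset S).val.map f + (Finset.univ : Finset T).val.map g := by
  rw [← Finset.univ_disjSum_univ, Finset.val_disjSum, Multiset.disjSum, Multiset.map_add,
    Multiset.map_map, Multiset.map_map]
  rfl

namespace HookBasis

variable {K V : Type*} [Field K] [AddCommGroup V] [Module K V] {x : Module.End K V} {m : ℕ}
  {u : ℕ → V} {f : V} {φ : ℕ → V →ₗ[K] K} {ψ : V →ₗ[K] K}

theorem commute_pow_add_hookSwap (h : HookBasis x m u f φ ψ) (hm : 2 ≤ m) (k : ℕ) (a b : K) :
    Commute x (x ^ k + hookSwap m u f φ ψ a b) :=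
  ((Commute.refl x).pow_right k).add_right
    ((h.mul_hookSwap hm a b).trans (h.hookSwap_mul hm a b).symm)

theorem pow_add_hookSwap_u (h : HookBasis x m u f φ ψ) (hm : 2 ≤ m) (k : ℕ) (a b : K) (i : ℕ) :
    (x ^ k + hookSwap m u f φ ψ a b) (u i) = u (i + k) + if i = 0 then a • f else 0 := by
  rw [LinearMap.add_apply, h.pow_u, h.hookSwap_u hm]

theorem pow_add_hookSwap_u_of_pos (h : HookBasis x m u f φ ψ) (hm : 2 ≤ m) (k : ℕ) (a b : K)
    {i : ℕ} (hi : 1 ≤ i) :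
    (x ^ k + hookSwap m u f φ ψ a b) (u i) = u (i + k) := by
  rw [h.pow_add_hookSwap_u hm, if_neg (by omega), add_zero]

theorem pow_add_hookSwap_f (h : HookBasis x m u f φ ψ) {k : ℕ} (hk : 1 ≤ k) (a b : K) :
    (x ^ k + hookSwap m u f φ ψ a b) f = b • u (m - 1) := by
  rw [LinearMap.add_apply, h.pow_f hk, h.hookSwap_f, zero_add]

theorem jordanGenerators_pow (h : HookBasis x m u f φ ψ) {c d q : ℕ} (hd : 1 ≤ d)
    (hm : m = c * (q + 1) + d * q) :
    JordanGenerators (x ^ (c + d))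
      (Sum.elim (fun _ => q + 1) (Sum.elim (fun _ => q) fun _ => 1) : Fin c ⊕ Fin d ⊕ Unit → ℕ)
      (Sum.elim (fun i => u i) (Sum.elim (fun i => u (c + i)) fun _ => f)) := by
  have hm' : m = (c + d) * q + c := by rw [hm]; ring
  have hpow : ∀ i j, ((x ^ (c + d)) ^ j) (u i) = u (i + (c + d) * j) := fun i j => by
    rw [← pow_mul, h.pow_u]
  refine ⟨?_, h.eq_top ?_ ?_⟩
  · rintro (i | i | i)
    · simp only [Sum.elim_inl, hpow]
      exact h.u_eq_zero _ (by rw [hm', mul_add]; omega)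
    · simp only [Sum.elim_inr, Sum.elim_inl, hpow]
      exact h.u_eq_zero _ (by rw [hm']; omega)
    · simpa using h.pow_f (show 1 ≤ c + d by omega)
  · intro i hi
    have hdm := Nat.mod_add_div i (c + d)
    have hlt := Nat.mod_lt i (show c + d > 0 by omega)
    have hq : i / (c + d) ≤ q := Nat.le_of_lt_succ <| Nat.div_lt_of_lt_mul <| by
      rw [Nat.mul_succ]; omega
    set r := i % (c + d)
    set j := i / (c + d)
    by_cases hr : r < c
    · refine Submodule.subset_span ⟨⟨Sum.inl ⟨r, hr⟩, ⟨j, by simp; omega⟩⟩, ?_⟩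
      simp only [Sum.elim_inl, hpow, hdm]
    · have hjq : j ≠ q := by
        rintro hjq
        rw [hjq] at hdm
        omega
      refine Submodule.subset_span ⟨⟨Sum.inr (Sum.inl ⟨r - c, by omega⟩), ⟨j, by simp; omega⟩⟩, ?_⟩
      simp only [Sum.elim_inl, Sum.elim_inr, hpow]
      congr 1
      omega
  · exact Submodule.subset_span ⟨⟨Sum.inr (Sum.inr ()), ⟨0, by simp⟩⟩, rfl⟩

theorem jordanGenerators_two (h : HookBasis x m u f φ ψ) {k : ℕ} (hk : 1 ≤ k)
    (hm : m = 2 * k + 1) :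
    JordanGenerators (x ^ k + hookSwap m u f φ ψ 1 (-1)) (fun _ : Fin (k + 1) => 2)
      fun i => u i := by
  have hm2 : 2 ≤ m := by omega
  set y := x ^ k + hookSwap m u f φ ψ 1 (-1)
  have hy0 : y (u 0) = u k + f := by
    rw [h.pow_add_hookSwap_u hm2, if_pos rfl, one_smul, zero_add]
  have hy : ∀ i, 1 ≤ i → y (u i) = u (i + k) := fun i => h.pow_add_hookSwap_u_of_pos hm2 k 1 (-1)
  have hyf : y f = - u (m - 1) := by rw [h.pow_add_hookSwap_f hk, neg_one_smul]
  have hmem : ∀ i ≤ k, u i ∈ Submodule.span K (Set.range fun a : (_ : Fin (k + 1)) × Fin 2 =>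
      (y ^ (a.2 : ℕ)) (u a.1)) := fun i hi =>
    Submodule.subset_span ⟨⟨⟨i, by omega⟩, 0⟩, rfl⟩
  refine ⟨fun i => ?_, h.eq_top (fun i hi => ?_) ?_⟩
  · rw [pow_two, Module.End.mul_apply]
    beta_reduce
    by_cases hi : (i : ℕ) = 0
    · rw [hi, hy0, map_add, hy k hk, hyf, show m - 1 = k + k by omega, add_neg_cancel]
    · rw [hy _ (by omega), hy _ (by omega), h.u_eq_zero _ (by omega)]
  · by_cases hik : i ≤ k
    · exact hmem i hik
    · refine Submodule.subset_span ⟨⟨⟨i - k, by omega⟩, 1⟩, ?_⟩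
      simp only [Fin.val_one, pow_one]
      rw [hy _ (by omega)]
      congr 1
      omega
  · have : u k + f ∈ Submodule.span K (Set.range fun a : (_ : Fin (k + 1)) × Fin 2 =>
        (y ^ (a.2 : ℕ)) (u a.1)) := by
      refine Submodule.subset_span ⟨⟨⟨0, by omega⟩, 1⟩, ?_⟩
      simp [hy0]
    simpa using sub_mem this (hmem k le_rfl)

theorem jordanGenerators_three (h : HookBasis x m u f φ ψ) {j t : ℕ} (ht : 2 ≤ t)
    (hm : m = 2 * j + t + 2) :
    JordanGenerators (x ^ (j + t) + hookSwap m u f φ ψ 1 1)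
      (Sum.elim (fun _ => 3) (Sum.elim (fun _ => 2) fun _ => 1) : Unit ⊕ Fin j ⊕ Fin t → ℕ)
      (Sum.elim (fun _ => u 0)
        (Sum.elim (fun i => u (i + 1)) fun i => u (j + 1 + i) - if (i : ℕ) = 0 then f else 0)) := by
  have hm2 : 2 ≤ m := by omega
  set y := x ^ (j + t) + hookSwap m u f φ ψ 1 1
  have hy0 : y (u 0) = u (j + t) + f := by
    rw [h.pow_add_hookSwap_u hm2, if_pos rfl, one_smul, zero_add]
  have hy : ∀ i, 1 ≤ i → y (u i) = u (i + (j + t)) := fun i =>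
    h.pow_add_hookSwap_u_of_pos hm2 (j + t) 1 1
  have hyf : y f = u (m - 1) := by rw [h.pow_add_hookSwap_f (by omega), one_smul]
  have hyy0 : y (y (u 0)) = u (m - 1) := by
    rw [hy0, map_add, hy _ (by omega), hyf, h.u_eq_zero (j + t + (j + t)) (by omega), zero_add]
  set W := Submodule.span K (Set.range fun a : (s : Unit ⊕ Fin j ⊕ Fin t) ×
    Fin (Sum.elim (fun _ => 3) (Sum.elim (fun _ => 2) fun _ => 1) s) =>
      (y ^ (a.2 : ℕ)) (Sum.elim (fun _ => u 0)
        (Sum.elim (fun i : Fin j => u (i + 1))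
          fun i : Fin t => u (j + 1 + i) - if (i : ℕ) = 0 then f else 0) a.1))
  have hmem' : ∀ i ≤ j + t, i ≠ j + 1 → u i ∈ W := by
    intro i hi hij
    rcases Nat.eq_zero_or_pos i with rfl | hi0
    · exact Submodule.subset_span ⟨⟨Sum.inl (), ⟨0, by simp⟩⟩, rfl⟩
    · by_cases hij : i ≤ j
      · refine Submodule.subset_span ⟨⟨Sum.inr (Sum.inl ⟨i - 1, by omega⟩), ⟨0, by simp⟩⟩, ?_⟩
        simp only [Sum.elim_inr, Sum.elim_inl, pow_zero, Module.End.one_apply]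
        congr 1
        omega
      · refine Submodule.subset_span ⟨⟨Sum.inr (Sum.inr ⟨i - (j + 1), by omega⟩),
          ⟨0, by simp⟩⟩, ?_⟩
        simp only [Sum.elim_inr, pow_zero, Module.End.one_apply]
        rw [if_neg (by omega), sub_zero]
        congr 1
        omega
  have hf : f ∈ W := by
    have : u (j + t) + f ∈ W := by
      refine Submodule.subset_span ⟨⟨Sum.inl (), ⟨1, by simp⟩⟩, ?_⟩
      simp [hy0]
    simpa using sub_mem this (hmem' (j + t) le_rfl (by omega))
  have hmem : ∀ i ≤ j + t, u i ∈ W := by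
    intro i hi
    by_cases hij : i = j + 1
    · have : u (j + 1) - f ∈ W :=
        Submodule.subset_span ⟨⟨Sum.inr (Sum.inr ⟨0, by omega⟩), ⟨0, by simp⟩⟩, by simp⟩
      simpa [hij] using add_mem this hf
    · exact hmem' i hi hij
  refine ⟨?_, h.eq_top (fun i hi => ?_) hf⟩
  · rintro (i | i | i)
    · simp only [Sum.elim_inl, pow_succ', pow_zero, Module.End.mul_apply, Module.End.one_apply]
      rw [hyy0, hy _ (by omega), h.u_eq_zero _ (by omega)]
    · simp only [Sum.elim_inl, Sum.elim_inr, pow_two, Module.End.mul_apply]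
      rw [hy _ (by omega), hy _ (by omega), h.u_eq_zero _ (by omega)]
    · simp only [Sum.elim_inr, pow_one, map_sub]
      rw [hy _ (by omega)]
      split_ifs with hi
      · rw [hyf, hi, sub_eq_zero]
        congr 1
        omega
      · rw [h.u_eq_zero _ (by omega), map_zero, sub_zero]
  · by_cases hij : i ≤ j + t
    · exact hmem i hij
    · by_cases him : i = m - 1
      · refine Submodule.subset_span ⟨⟨Sum.inl (), ⟨2, by simp⟩⟩, ?_⟩
        simp only [Sum.elim_inl, pow_two, Module.End.mul_apply]
        rw [hyy0, him]
      · refine Submodule.subset_span ⟨⟨Sum.inr (Sum.inl ⟨i - (j + t) - 1, by omega⟩),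
          ⟨1, by simp⟩⟩, ?_⟩
        simp only [Sum.elim_inr, Sum.elim_inl, pow_one]
        rw [hy _ (by omega)]
        congr 1
        omega

theorem jordanGenerators_unit (h : HookBasis x 2 u f φ ψ) :
    JordanGenerators (x ^ 2 + hookSwap 2 u f φ ψ 1 1) (fun _ : Unit => 3) fun _ => u 0 := by
  set y := x ^ 2 + hookSwap 2 u f φ ψ 1 1
  have hy0 : y (u 0) = f := by
    rw [h.pow_add_hookSwap_u le_rfl, if_pos rfl, one_smul, h.u_eq_zero _ le_rfl, zero_add]
  have hyf : y f = u 1 := by rw [h.pow_add_hookSwap_f (by omega), one_smul]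
  have hy1 : y (u 1) = 0 := by
    rw [h.pow_add_hookSwap_u_of_pos le_rfl 2 1 1 le_rfl, h.u_eq_zero _ (by omega)]
  refine ⟨fun _ => ?_, h.eq_top (fun i hi => ?_) ?_⟩
  · simp [pow_succ', hy0, hyf, hy1]
  · interval_cases i
    · exact Submodule.subset_span ⟨⟨(), 0⟩, rfl⟩
    · exact Submodule.subset_span ⟨⟨(), 2⟩, by simp [pow_two, hy0, hyf]⟩
  · exact Submodule.subset_span ⟨⟨(), 1⟩, by simp [hy0]⟩

end HookBasis

theorem exists_hasJordanPartition (K : Type*) [Field K] {n : ℕ} (mu : Nat.Partition n) :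
    ∃ X : Matrix (Fin n) (Fin n) K, HasJordanPartition X mu := by
  obtain ⟨L, hL⟩ := Quot.exists_rep mu.parts
  exact ⟨_, L, hL, Fintype.equivOfCardEq (card_sigma_get hL), 1, rfl⟩
theorem Multiset.eq_replicate_add_replicate {α : Type*} [DecidableEq α] {s : Multiset α} {a b : α}
    (hab : a ≠ b) (h : ∀ p ∈ s, p = a ∨ p = b) :
    s = Multiset.replicate (s.count a) a + Multiset.replicate (s.count b) b := by
  conv_lhs => rw [← Multiset.filter_add_not (fun p => p = a) s]
  rw [Multiset.filter_eq', ← Multiset.filter_eq' s b]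
  congr 1
  refine Multiset.filter_congr fun p hp => ⟨fun hpa => (h p hp).resolve_left hpa, ?_⟩
  rintro rfl
  exact hab.symm

theorem HookBasis.exists_commute {K : Type*} [Field K] {n m : ℕ} {X : Matrix (Fin n) (Fin n) K}
    {u : ℕ → Fin n → K} {f : Fin n → K} {φ : ℕ → (Fin n → K) →ₗ[K] K} {ψ : (Fin n → K) →ₗ[K] K}
    (h : HookBasis (Matrix.toLin' X) m u f φ ψ) (hm : 2 ≤ m) {k : ℕ} {a b : K}
    {S : Type*} [Fintype S] {l : S → ℕ} {w : S → Fin n → K}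
    (hw : JordanGenerators (Matrix.toLin' X ^ k + hookSwap m u f φ ψ a b) l w)
    {mu : Nat.Partition n} (hl : (Finset.univ : Finset S).val.map l = mu.parts) :
    ∃ Y, HasJordanPartition Y mu ∧ Commute X Y := by
  refine ⟨LinearMap.toMatrix' (Matrix.toLin' X ^ k + hookSwap m u f φ ψ a b),
    (hasJordanPartition_iff l hl).2 ⟨w, by rwa [Matrix.toLin'_toMatrix']⟩, ?_⟩
  have hc := h.commute_pow_add_hookSwap hm k a b
  apply Matrix.toLin'.injective
  rw [Matrix.toLin'_mul, Matrix.toLin'_mul, Matrix.toLin'_toMatrix']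
  exact hc

theorem exists_commute_of_parts {K : Type*} [Field K] {n m : ℕ} (hn : n = m + 1) (hm : 2 ≤ m)
    {lam : Nat.Partition n} {X : Matrix (Fin n) (Fin n) K} {ρ : Nat.Partition n}
    (hρ : ρ.parts = {m, 1}) (hX : HasJordanPartition X ρ)
    (h : (1 ∈ lam.parts ∧
          ∀ a ∈ lam.parts.erase 1, ∀ b ∈ lam.parts.erase 1, a ≤ b + 1) ∨
       (Even n ∧ ∀ p ∈ lam.parts, p = 2) ∨
       (3 ∈ lam.parts ∧ (∀ p ∈ lam.parts.erase 3, p = 1 ∨ p = 2) ∧ 1 ∈ lam.parts) ∨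
       (n = 3 ∧ lam.parts = {3})) :
    ∃ Y, HasJordanPartition Y lam ∧ Commute X Y := by
  obtain ⟨u, f, φ, ψ, hb⟩ := exists_hookBasis hn hρ hX
  have almost_rect : 1 ∈ lam.parts →
      (∀ a ∈ lam.parts.erase 1, ∀ b ∈ lam.parts.erase 1, a ≤ b + 1) →
      ∃ Y, HasJordanPartition Y lam ∧ Commute X Y := by
    intro h1 hrect
    have hcons := Multiset.cons_erase h1
    set s := lam.parts.erase 1 with hs
    have hsum : s.sum = m := by
      have := lam.parts_sum
      rw [← hcons, Multiset.sum_cons] at this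
      omega
    have hs0 : s ≠ 0 := by
      rintro h0
      rw [h0, Multiset.sum_zero] at hsum
      omega
    obtain ⟨q, hq, hqmin⟩ : ∃ q ∈ s, ∀ b ∈ s, q ≤ b := by
      obtain ⟨a, ha⟩ := Multiset.exists_mem_of_ne_zero hs0
      obtain ⟨q, hq, hqmin⟩ := s.toFinset.exists_min_image id ⟨a, Multiset.mem_toFinset.2 ha⟩
      exact ⟨q, Multiset.mem_toFinset.1 hq, fun b hb => hqmin b (Multiset.mem_toFinset.2 hb)⟩
    have hrep := Multiset.eq_replicate_add_replicate (s := s) (a := q + 1) (b := q) (by omega)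
      fun p hp => by
        have := hrect p hp q hq
        have := hqmin p hp
        omega
    set c := s.count (q + 1)
    have hd : 1 ≤ s.count q := Multiset.one_le_count_iff_mem.2 hq
    set d := s.count q
    have hmcd : m = c * (q + 1) + d * q := by
      rw [← hsum, hrep]
      simp
    have hgen := hb.jordanGenerators_pow hd hmcd
    have hzero : hookSwap m u f φ ψ 0 0 = 0 := by simp [hookSwap]
    rw [← add_zero (Matrix.toLin' X ^ (c + d)), ← hzero] at hgen
    refine hb.exists_commute hm hgen ?_
    rw [map_univ_sumElim, map_univ_sumElim, ← hcons, hrep]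
    simp only [Multiset.map_const', Finset.card_val, Finset.card_univ, Fintype.card_fin,
      Fintype.card_unit, Multiset.replicate_one]
    rw [← add_assoc, add_comm, Multiset.singleton_add]
  rcases h with ⟨h1, h2⟩ | ⟨⟨k, hk⟩, h2⟩ | ⟨h3, h12, h1⟩ | ⟨h3, h4⟩
  · exact almost_rect h1 h2
  · obtain ⟨k, rfl⟩ : ∃ k', k = k' + 1 := ⟨k - 1, by omega⟩
    refine hb.exists_commute hm (hb.jordanGenerators_two (k := k) (by omega) (by omega)) ?_
    have hrep := Multiset.eq_replicate_card.2 h2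
    have hsum := lam.parts_sum
    rw [hrep, Multiset.sum_replicate, smul_eq_mul] at hsum
    rw [hrep, show lam.parts.card = k + 1 by omega]
    simp
  · have hcons := Multiset.cons_erase h3
    set s := lam.parts.erase 3
    have hrep := Multiset.eq_replicate_add_replicate (s := s) (a := 2) (b := 1) (by omega)
      fun p hp => (h12 p hp).symm
    set j := s.count 2
    set t := s.count 1 with ht
    have ht1 : 1 ≤ t := Multiset.one_le_count_iff_mem.2 <|
      (Multiset.mem_cons.1 (hcons ▸ h1)).resolve_left (by omega)
    rcases ht1.eq_or_lt with ht1 | ht1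
    · apply almost_rect h1
      have herase : lam.parts.erase 1 = 3 ::ₘ Multiset.replicate j 2 := by
        rw [← hcons, hrep, ← ht1, Multiset.erase_cons_tail _ (by omega), add_comm]
        simp
      rw [herase]
      intro a ha b hb
      rw [Multiset.mem_cons] at ha hb
      have ha' := ha.imp_right Multiset.eq_of_mem_replicate
      have hb' := hb.imp_right Multiset.eq_of_mem_replicate
      omega
    · have hsum := lam.parts_sum
      rw [← hcons, hrep] at hsum
      simp only [Multiset.sum_cons, Multiset.sum_add, Multiset.sum_replicate, smul_eq_mul] at hsum
      refine hb.exists_commute hm (hb.jordanGenerators_three (j := j) (t := t) ht1 (by omega)) ?_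
      rw [map_univ_sumElim, map_univ_sumElim, ← hcons, hrep]
      simp only [Multiset.map_const', Finset.card_val, Finset.card_univ, Fintype.card_fin,
        Fintype.card_unit, Multiset.replicate_one, Multiset.singleton_add]
  · obtain rfl : m = 2 := by omega
    refine hb.exists_commute hm hb.jordanGenerators_unit ?_
    rw [h4]
    rfl
namespace HookBasis

variable {K V : Type*} [Field K] [AddCommGroup V] [Module K V] {x : Module.End K V} {m : ℕ}
  {u : ℕ → V} {f : V} {φ : ℕ → V →ₗ[K] K} {ψ : V →ₗ[K] K}

theorem pow_eq_zero (h : HookBasis x m u f φ ψ) (hm : 1 ≤ m) {j : ℕ} (hj : m ≤ j) :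
    x ^ j = 0 := by
  apply h.end_ext
  · intro i _
    rw [h.pow_u, h.u_eq_zero _ (by omega), LinearMap.zero_apply]
  · rw [h.pow_f (by omega), LinearMap.zero_apply]

theorem pow_pred_eq (h : HookBasis x m u f φ ψ) (hm : 2 ≤ m) :
    x ^ (m - 1) = (φ 0).smulRight (u (m - 1)) := by
  apply h.end_ext
  · intro i _
    rw [h.pow_u, LinearMap.smulRight_apply, h.φ_u 0 i (by omega)]
    split_ifs with hi
    · rw [hi, zero_add, one_smul]
    · rw [h.u_eq_zero _ (by omega), zero_smul]
  · rw [h.pow_f (by omega), LinearMap.smulRight_apply, h.φ_f, zero_smul]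

theorem φ_x (h : HookBasis x m u f φ ψ) {k : ℕ} (hk : k + 1 < m) (v : V) :
    φ (k + 1) (x v) = φ k v := by
  conv_lhs => rw [h.expand v]
  rw [map_add, map_smul, h.x_f, smul_zero, add_zero, map_sum, map_sum,
    Finset.sum_eq_single_of_mem k (Finset.mem_range.2 (by omega))]
  · rw [map_smul, h.x_u, map_smul, h.φ_u _ _ hk, if_pos rfl, smul_eq_mul, mul_one]
  · intro i _ hi
    rw [map_smul, h.x_u, map_smul, h.φ_u _ _ hk, if_neg (by omega), smul_zero]

theorem φ_zero_x (h : HookBasis x m u f φ ψ) (hm : 1 ≤ m) (v : V) : φ 0 (x v) = 0 := by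
  rw [h.expand v, map_add, map_smul, h.x_f, smul_zero, add_zero, map_sum, map_sum]
  refine Finset.sum_eq_zero fun i _ => ?_
  rw [map_smul, h.x_u, map_smul, h.φ_u _ _ hm, if_neg (by omega), smul_zero]

theorem ψ_x (h : HookBasis x m u f φ ψ) (v : V) : ψ (x v) = 0 := by
  rw [h.expand v, map_add, map_smul, h.x_f, smul_zero, add_zero, map_sum, map_sum]
  refine Finset.sum_eq_zero fun i _ => ?_
  rw [map_smul, h.x_u, map_smul, h.ψ_u, smul_zero]

theorem φ_pow (h : HookBasis x m u f φ ψ) {k : ℕ} (hk : k < m) (v : V) :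
    φ k ((x ^ k) v) = φ 0 v := by
  induction k with
  | zero => rfl
  | succ k ih => rw [pow_succ', Module.End.mul_apply, h.φ_x hk, ih (by omega)]

/-- Operators commuting with `x` act on the image of `x ^ (m - 1)` by a scalar. -/
theorem pow_pred_mul (h : HookBasis x m u f φ ψ) (hm : 2 ≤ m) {z : Module.End K V}
    (hz : Commute x z) : x ^ (m - 1) * z = φ 0 (z (u 0)) • x ^ (m - 1) := by
  have hzp : ∀ j v, (x ^ j) (z v) = z ((x ^ j) v) := fun j v =>
    LinearMap.congr_fun (hz.pow_left j) v
  apply h.end_ext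
  · intro i _
    rw [Module.End.mul_apply, LinearMap.smul_apply]
    by_cases hi : i = 0
    · rw [hi, h.pow_u, h.pow_pred_eq hm, LinearMap.smulRight_apply, zero_add]
    · rw [hzp, h.pow_u, h.u_eq_zero _ (by omega), map_zero, smul_zero]
  · rw [Module.End.mul_apply, LinearMap.smul_apply, hzp, h.pow_f (by omega), map_zero, smul_zero]

theorem eq_zero_of_smul_pow {W : Type*} [AddCommGroup W] [Module K W] {y : Module.End K W} {c : K}
    {θ : W →ₗ[K] K} {v : W} (hy : IsNilpotent y) (hθ : ∀ w, θ (y w) = c * θ w) (hv : θ v ≠ 0) :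
    c = 0 := by
  obtain ⟨N, hN⟩ := hy
  have hpow : ∀ N, θ ((y ^ N) v) = c ^ N * θ v := fun N => by
    induction N with
    | zero => simp
    | succ N ih => rw [pow_succ', Module.End.mul_apply, hθ, ih, pow_succ', mul_assoc]
  have := hpow N
  rw [hN, LinearMap.zero_apply, map_zero] at this
  exact eq_zero_of_pow_eq_zero ((mul_eq_zero.1 this.symm).resolve_right hv)

/-- A nilpotent operator commuting with `x` is a polynomial in `x` without constant term plus a
`hookSwap`. -/
theorem exists_aeval_add_hookSwap (h : HookBasis x m u f φ ψ) (hm : 2 ≤ m) {y : Module.End K V}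
    (hxy : Commute x y) (hy : IsNilpotent y) :
    ∃ (p : K[X]) (a b : K), p.coeff 0 = 0 ∧ y = aeval x p + hookSwap m u f φ ψ a b := by
  have hyp : ∀ j v, (x ^ j) (y v) = y ((x ^ j) v) := fun j v =>
    LinearMap.congr_fun (hxy.pow_left j) v
  have hxyf : x (y f) = 0 := by simpa [h.x_f] using hyp 1 f
  have hφf : ∀ k, k + 1 < m → φ k (y f) = 0 := fun k hk => by
    rw [← h.φ_x hk, hxyf, map_zero]
  have hyf : y f = φ (m - 1) (y f) • u (m - 1) + ψ (y f) • f := by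
    conv_lhs => rw [h.expand (y f)]
    rw [Finset.sum_eq_single_of_mem (m - 1) (Finset.mem_range.2 (by omega))]
    intro i hi hi'
    rw [hφf i (by have := Finset.mem_range.1 hi; omega), zero_smul]
  have hyu : ∀ i, y (u i) = (x ^ i) (y (u 0)) := fun i => by rw [hyp, h.pow_u, zero_add]
  have hc : φ 0 (y (u 0)) = 0 := by
    refine eq_zero_of_smul_pow hy (θ := φ 0) (v := u 0) (fun w => ?_) (by
      simp [h.φ_u 0 0 (by omega)])
    have : (φ 0) ∘ₗ y ∘ₗ x = 0 := by
      ext v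
      have := hyp 1 v
      rw [pow_one] at this
      rw [LinearMap.comp_apply, LinearMap.comp_apply, ← this, h.φ_zero_x (by omega)]
      rfl
    rw [h.expand w]
    simp only [map_add, map_sum, map_smul, hφf 0 (by omega), h.φ_f, smul_eq_mul, mul_zero, add_zero]
    rw [Finset.mul_sum]
    refine Finset.sum_congr rfl fun i _ => ?_
    rw [h.φ_u 0 i (by omega)]
    split_ifs with hi
    · rw [hi]
      ring
    · have := LinearMap.congr_fun this (u (i - 1))
      rw [LinearMap.comp_apply, LinearMap.comp_apply, h.x_u, Nat.sub_add_cancel (by omega)] at this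
      rw [this]
      simp
  have hyum : y (u (m - 1)) = 0 := by
    rw [hyu, h.pow_pred_eq hm, LinearMap.smulRight_apply, hc, zero_smul]
  have hd : ψ (y f) = 0 := by
    have hyyf : y (y f) = ψ (y f) • y f := by
      conv_lhs => rw [hyf, map_add, map_smul, map_smul, hyum, smul_zero, zero_add]
    have hpow : ∀ N, (y ^ N) (y f) = ψ (y f) ^ N • y f := fun N => by
      induction N with
      | zero => simp
      | succ N ih => rw [pow_succ', Module.End.mul_apply, ih, map_smul, hyyf, smul_smul, pow_succ]
    obtain ⟨N, hN⟩ := hy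
    have := congrArg ψ (hpow N)
    rw [hN, LinearMap.zero_apply, map_zero, map_smul, smul_eq_mul, ← pow_succ] at this
    exact eq_zero_of_pow_eq_zero this.symm
  let p : K[X] := ∑ i ∈ Finset.range m, C (φ i (y (u 0))) * X ^ i
  have hp : ∀ v, aeval x p v = ∑ i ∈ Finset.range m, φ i (y (u 0)) • (x ^ i) v := fun v => by
    simp only [p, map_sum, map_mul, aeval_C, map_pow, aeval_X, LinearMap.sum_apply,
      Module.End.mul_apply, Module.algebraMap_end_apply]
  refine ⟨p, ψ (y (u 0)), φ (m - 1) (y f), ?_, h.end_ext (fun i _ => ?_) ?_⟩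
  · simp only [p, finsetSum_coeff, coeff_C_mul, coeff_X_pow]
    refine Finset.sum_eq_zero fun i _ => ?_
    split_ifs with hi
    · rw [← hi, hc, zero_mul]
    · rw [mul_zero]
  · rw [LinearMap.add_apply, h.hookSwap_u hm, hp, hyu]
    conv_lhs => rw [h.expand (y (u 0))]
    rw [map_add, map_sum, map_smul]
    congr 1
    · refine Finset.sum_congr rfl fun j _ => ?_
      rw [map_smul, h.pow_u, h.pow_u, add_comm]
    · split_ifs with hi
      · rw [hi]; rfl
      · rw [h.pow_f (by omega), smul_zero]
  · rw [LinearMap.add_apply, h.hookSwap_f, hp, Finset.sum_eq_zero, zero_add]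
    · exact hyf.trans (by rw [hd, zero_smul, add_zero])
    · intro i _
      by_cases hi : i = 0
      · rw [hi, hc, zero_smul]
      · rw [h.pow_f (by omega), smul_zero]

end HookBasis
theorem finrank_range_mul_isUnit {K V : Type*} [Field K] [AddCommGroup V] [Module K V]
    (y : Module.End K V) {z : Module.End K V} (hz : IsUnit z) :
    Module.finrank K (LinearMap.range (y * z)) = Module.finrank K (LinearMap.range y) := by
  rw [Module.End.mul_eq_comp, LinearMap.range_comp_of_range_eq_top]
  exact LinearMap.range_eq_top.2 ((Module.End.isUnit_iff z).1 hz).2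

theorem finrank_range_isUnit_mul {K V : Type*} [Field K] [AddCommGroup V] [Module K V]
    {y : Module.End K V} (z : Module.End K V) (hy : IsUnit y) :
    Module.finrank K (LinearMap.range (y * z)) = Module.finrank K (LinearMap.range z) := by
  rw [Module.End.mul_eq_comp, LinearMap.range_comp]
  exact LinearEquiv.finrank_map_eq (LinearEquiv.ofBijective y ((Module.End.isUnit_iff y).1 hy)) _

theorem add_pow_of_mul_eq_zero {R : Type*} [Ring R] {a b : R} (hab : a * b = 0) (hba : b * a = 0)
    {j : ℕ} (hj : 1 ≤ j) : (a + b) ^ j = a ^ j + b ^ j := by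
  induction j, hj using Nat.le_induction with
  | base => simp
  | succ j hj ih =>
    rw [pow_succ, ih, add_mul, mul_add, mul_add, ← Nat.sub_add_cancel hj, pow_succ a, pow_succ b,
      mul_assoc _ a b, mul_assoc _ b a, hab, hba]
    simp [pow_succ]

namespace HookBasis

variable {K V : Type*} [Field K] [AddCommGroup V] [Module K V] {x : Module.End K V} {m : ℕ}
  {u : ℕ → V} {f : V} {φ : ℕ → V →ₗ[K] K} {ψ : V →ₗ[K] K}

theorem isUnit_aeval (h : HookBasis x m u f φ ψ) (hm : 1 ≤ m) {g : K[X]} (hg : g.coeff 0 ≠ 0) :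
    IsUnit (aeval x g) := by
  have hgx : aeval x g = algebraMap K _ (g.coeff 0) + aeval x g.divX * x := by
    conv_lhs => rw [← divX_mul_X_add g]
    simp [add_comm]
  have hcomm : Commute (aeval x g.divX) x := by
    simpa using ((Commute.all X g.divX).map (aeval x : K[X] →ₐ[K] Module.End K V)).symm
  rw [hgx]
  refine IsNilpotent.isUnit_add_left_of_commute ?_ ((IsUnit.mk0 _ hg).map _)
    (Algebra.commutes _ _).symm
  exact hcomm.isNilpotent_mul_left ⟨m, h.pow_eq_zero hm le_rfl⟩

theorem exists_pow_mul_add_hookSwap (h : HookBasis x m u f φ ψ) (hm : 2 ≤ m)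
    {y : Module.End K V} (hxy : Commute x y) (hy : IsNilpotent y) :
    ∃ (k : ℕ) (z : Module.End K V) (a b : K), 1 ≤ k ∧ k ≤ m ∧ IsUnit z ∧ Commute x z ∧
      y = x ^ k * z + hookSwap m u f φ ψ a b := by
  obtain ⟨p, a, b, hp0, hp⟩ := h.exists_aeval_add_hookSwap hm hxy hy
  by_cases hp' : aeval x p = 0
  · refine ⟨m, 1, a, b, by omega, le_rfl, isUnit_one, Commute.one_right x, ?_⟩
    rw [h.pow_eq_zero (by omega) le_rfl, zero_mul, hp, hp']
  · have hpz : p ≠ 0 := by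
      rintro rfl
      exact hp' (map_zero _)
    obtain ⟨g, hg, hgX⟩ := exists_eq_pow_rootMultiplicity_mul_and_not_dvd p hpz 0
    rw [C_0, sub_zero] at hg hgX
    set k := p.rootMultiplicity 0
    rw [X_dvd_iff] at hgX
    have hpx : aeval x p = x ^ k * aeval x g := by
      conv_lhs => rw [hg]
      simp
    refine ⟨k, aeval x g, a, b, ?_, ?_, h.isUnit_aeval (by omega) hgX, ?_, by rw [hp, hpx]⟩
    · by_contra hk
      rw [show k = 0 by omega, pow_zero, one_mul] at hg
      exact hgX (hg ▸ hp0)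
    · by_contra hk
      exact hp' (by rw [hpx, h.pow_eq_zero (by omega) (by omega), zero_mul])
    · simpa using ((Commute.all X g).map (aeval x : K[X] →ₐ[K] Module.End K V))

theorem finrank_range_pow_mul_add_hookSwap (h : HookBasis x m u f φ ψ) {k : ℕ} (hk : k + 1 < m)
    {z : Module.End K V} (hz : IsUnit z) (hxz : Commute x z) (a b : K) :
    Module.finrank K (LinearMap.range (x ^ k * z + hookSwap m u f φ ψ a b)) =
      Module.finrank K (LinearMap.range (x ^ k)) := by
  obtain ⟨z, rfl⟩ := hz
  have hxz' : Commute x (↑z⁻¹ : Module.End K V) := hxz.units_inv_right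
  set v : Module.End K V := ↑z⁻¹
  have hzv : (z : Module.End K V) * v = 1 := z.mul_inv
  have hvz : v * (z : Module.End K V) = 1 := z.inv_mul
  have hvp : ∀ j w, v ((x ^ j) w) = (x ^ j) (v w) := fun j w =>
    (LinearMap.congr_fun (hxz'.pow_left j) w).symm
  let p : Module.End K V := a • (φ k).smulRight f
  let q : Module.End K V := b • ψ.smulRight (u (m - 1 - k))
  have hswap : hookSwap m u f φ ψ a b = p * x ^ k + x ^ k * q := by
    ext w
    simp only [hookSwap, p, q, LinearMap.add_apply, LinearMap.smul_apply,
      LinearMap.smulRight_apply, Module.End.mul_apply, h.φ_pow (show k < m by omega), map_smul,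
      h.pow_u]
    rw [Nat.sub_add_cancel (by omega)]
  have hcross : p * v * (x ^ k * q) = 0 := by
    ext w
    simp only [p, q, LinearMap.smul_apply, LinearMap.smulRight_apply, Module.End.mul_apply,
      map_smul, hvp, LinearMap.zero_apply]
    rw [show u (m - 1 - k) = (x ^ (m - 1 - k)) (u 0) by rw [h.pow_u, zero_add], hvp,
      h.φ_pow (show k < m by omega), ← Nat.sub_add_cancel (show 1 ≤ m - 1 - k by omega), pow_succ',
      Module.End.mul_apply, h.φ_zero_x (by omega)]
    simp
  have hp : (p * v) * (p * v) = 0 := by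
    ext w
    simp only [p, LinearMap.smul_apply, LinearMap.smulRight_apply, Module.End.mul_apply,
      map_smul, LinearMap.zero_apply]
    rw [← h.φ_x hk (v f), ← pow_one x, ← hvp, pow_one, h.x_f]
    simp
  have hq : (v * q) * (v * q) = 0 := by
    ext w
    simp only [q, LinearMap.smul_apply, LinearMap.smulRight_apply, Module.End.mul_apply,
      map_smul, LinearMap.zero_apply]
    rw [show u (m - 1 - k) = (x ^ (m - 1 - k)) (u 0) by rw [h.pow_u, zero_add], hvp,
      ← Nat.sub_add_cancel (show 1 ≤ m - 1 - k by omega), pow_succ', Module.End.mul_apply, h.ψ_x]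
    simp
  have hfac : x ^ k * z + hookSwap m u f φ ψ a b = (1 + p * v) * (x ^ k * z * (1 + v * q)) := by
    have h1 : x ^ k * ↑z * (v * q) = x ^ k * q := by
      rw [mul_assoc, ← mul_assoc (z : Module.End K V), hzv, one_mul]
    have h2 : p * v * (x ^ k * ↑z) = p * x ^ k := by
      rw [(hxz.pow_left k).eq, mul_assoc, ← mul_assoc v, hvz, one_mul]
    rw [mul_add, mul_one, h1, add_mul, one_mul, mul_add, h2, hcross, hswap]
    abel
  rw [hfac, finrank_range_isUnit_mul, finrank_range_mul_isUnit, finrank_range_mul_isUnit _ z.isUnit]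
  · exact IsNilpotent.isUnit_one_add ⟨2, by rw [pow_two, hq]⟩
  · exact IsNilpotent.isUnit_one_add ⟨2, by rw [pow_two, hp]⟩

/-- The possible ranks of the powers of a nilpotent operator commuting with `x`. -/
theorem finrank_range_pow_cases [FiniteDimensional K V] (h : HookBasis x m u f φ ψ) (hm : 2 ≤ m)
    (hx : ∀ j, 1 ≤ j → Module.finrank K (LinearMap.range (x ^ j)) = m - j)
    {y : Module.End K V} (hxy : Commute x y) (hy : IsNilpotent y) {r : ℕ → ℕ}
    (hr : ∀ j, r j = Module.finrank K (LinearMap.range (y ^ j))) :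
    ∃ k, 1 ≤ k ∧ k ≤ m ∧ ((∀ j, 1 ≤ j → r j = m - j * k) ∨
      (m = 2 * k + 1 ∧ r 1 = m - k ∧ r 2 = 0) ∨
      (r 2 = 1 ∧ r 3 = 0 ∧ (2 * r 1 ≤ m ∨ r 1 ≤ 2))) := by
  classical
  obtain ⟨k, z, a, b, hk1, hkm, hz, hxz, rfl⟩ := h.exists_pow_mul_add_hookSwap hm hxy hy
  set e := hookSwap m u f φ ψ a b with he
  have hxe : ∀ j, 1 ≤ j → x ^ j * e = 0 := fun j hj => by
    rw [← Nat.sub_add_cancel hj, pow_succ, mul_assoc, h.mul_hookSwap hm, mul_zero]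
  have hex : ∀ j, 1 ≤ j → e * x ^ j = 0 := fun j hj => by
    rw [← Nat.sub_add_cancel hj, pow_succ', ← mul_assoc, h.hookSwap_mul hm, zero_mul]
  have hpow : ∀ j, 1 ≤ j → (x ^ k * z + e) ^ j = x ^ (j * k) * z ^ j + e ^ j := fun j hj => by
    rw [add_pow_of_mul_eq_zero _ _ hj, (hxz.pow_left k).mul_pow, ← pow_mul, mul_comm k]
    · rw [(hxz.pow_left k).eq, mul_assoc, hxe k hk1, mul_zero]
    · rw [← mul_assoc, hex k hk1, zero_mul]
  have hsq : (x ^ k * z + e) ^ 2 = x ^ (2 * k) * z ^ 2 + (a * b) • x ^ (m - 1) := by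
    rw [hpow 2 (by omega), h.hookSwap_sq hm]
  have hr0 : Module.finrank K (LinearMap.range (0 : Module.End K V)) = 0 := by simp
  have hlarge : ∀ j, 3 ≤ j → r j = m - j * k := fun j hj => by
    rw [hr, hpow j (by omega), h.hookSwap_pow hm _ _ hj, add_zero,
      finrank_range_mul_isUnit _ (hz.pow j), hx _ (Nat.mul_pos (by omega) hk1)]
  have hr2 : m - 1 < 2 * k → r 2 = if a * b = 0 then 0 else 1 := fun hk => by
    rw [hr, hsq, h.pow_eq_zero (by omega) (by omega), zero_mul, zero_add]
    split_ifs with hab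
    · rw [hab, zero_smul, hr0]
    · rw [LinearMap.range_smul _ _ hab, hx _ (by omega)]
      omega
  by_cases hk : k + 1 < m
  · have hr1 : r 1 = m - k := by
      rw [hr, pow_one, h.finrank_range_pow_mul_add_hookSwap hk hz hxz, hx k hk1]
    have generic : r 2 = m - 2 * k → ∀ j, 1 ≤ j → r j = m - j * k := fun h2 j hj => by
      obtain rfl | rfl | hj : j = 1 ∨ j = 2 ∨ 3 ≤ j := by omega
      · rw [hr1, one_mul]
      · exact h2
      · exact hlarge j hj
    refine ⟨k, hk1, hkm, ?_⟩
    rcases lt_trichotomy (2 * k) (m - 1) with hlt | heq | hgt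
    · refine Or.inl (generic ?_)
      have hfac : x ^ (2 * k) * z ^ 2 + (a * b) • x ^ (m - 1) =
          x ^ (2 * k) * (z ^ 2 + (a * b) • x ^ (m - 1 - 2 * k)) := by
        rw [mul_add, mul_smul_comm, ← pow_add, show 2 * k + (m - 1 - 2 * k) = m - 1 by omega]
      rw [hr, hsq, hfac, finrank_range_mul_isUnit, hx _ (by omega)]
      refine IsNilpotent.isUnit_add_left_of_commute ?_ (hz.pow 2)
        (((hxz.pow_pow _ 2)).smul_left _)
      refine IsNilpotent.smul ⟨m, ?_⟩ _
      rw [← pow_mul]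
      exact h.pow_eq_zero (by omega) (Nat.le_mul_of_pos_left m (by omega))
    · have hsq' : (x ^ k * z + e) ^ 2 = (φ 0 ((z ^ 2) (u 0)) + a * b) • x ^ (m - 1) := by
        rw [hsq, heq, h.pow_pred_mul hm (hxz.pow_right 2), add_smul]
      by_cases hc : φ 0 ((z ^ 2) (u 0)) + a * b = 0
      · refine Or.inr (Or.inl ⟨by omega, hr1, ?_⟩)
        rw [hr, hsq', hc, zero_smul, hr0]
      · refine Or.inl (generic ?_)
        rw [hr, hsq', LinearMap.range_smul _ _ hc, hx _ (by omega), heq]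
    · have := hr2 hgt
      split_ifs at this
      · exact Or.inl (generic (by omega))
      · refine Or.inr (Or.inr ⟨this, ?_, by omega⟩)
        rw [hlarge 3 le_rfl]
        omega
  · have hr3 : ∀ j, 3 ≤ j → r j = 0 := fun j hj => by
      rw [hlarge j hj, Nat.sub_eq_zero_iff_le]
      nlinarith
    have hr2 := hr2 (by omega)
    obtain ⟨c, hc⟩ : ∃ c : K, x ^ k * z = c • x ^ (m - 1) := by
      by_cases hk' : k = m - 1
      · exact ⟨_, by rw [hk', h.pow_pred_mul hm hxz]⟩
      · exact ⟨0, by rw [h.pow_eq_zero (by omega) (by omega), zero_mul, zero_smul]⟩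
    have hy : x ^ k * z + e =
        (φ 0).smulRight (c • u (m - 1) + a • f) + ψ.smulRight (b • u (m - 1)) := by
      rw [hc, h.pow_pred_eq hm, he, hookSwap]
      ext w
      simp only [LinearMap.add_apply, LinearMap.smul_apply, LinearMap.smulRight_apply, smul_add,
        smul_comm (φ 0 w), smul_comm (ψ w)]
      abel
    by_cases hab : a * b = 0
    · rw [if_pos hab] at hr2
      have hr1 : r 1 ≤ 1 := by
        suffices ∃ v, LinearMap.range (x ^ k * z + e) ≤ Submodule.span K {v} by
          obtain ⟨v, hv⟩ := this
          rw [hr, pow_one]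
          exact (Submodule.finrank_mono hv).trans ((finrank_span_le_card {v}).trans (by simp))
        rcases mul_eq_zero.1 hab with ha | hb
        · refine ⟨u (m - 1), ?_⟩
          rintro _ ⟨w, rfl⟩
          rw [hy, ha, zero_smul, add_zero, Submodule.mem_span_singleton]
          exact ⟨φ 0 w * c + ψ w * b, by
            simp only [LinearMap.add_apply, LinearMap.smulRight_apply, smul_smul, add_smul]⟩
        · refine ⟨c • u (m - 1) + a • f, ?_⟩
          rintro _ ⟨w, rfl⟩
          rw [hy, hb, Submodule.mem_span_singleton]
          exact ⟨φ 0 w, by simp⟩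
      have hrj : ∀ j, 2 ≤ j → r j = 0 := fun j hj => by
        rcases hj.eq_or_lt with rfl | hj
        · exact hr2
        · exact hr3 j hj
      refine ⟨m - r 1, by omega, by omega, Or.inl fun j hj => ?_⟩
      rcases hj.eq_or_lt with rfl | hj
      · omega
      · rw [hrj j hj, eq_comm, Nat.sub_eq_zero_iff_le]
        calc m ≤ 2 * (m - r 1) := by omega
          _ ≤ j * (m - r 1) := Nat.mul_le_mul_right _ hj
    · rw [if_neg hab] at hr2
      refine ⟨k, hk1, hkm, Or.inr (Or.inr ⟨hr2, hr3 3 le_rfl, Or.inr ?_⟩)⟩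
      have hle : LinearMap.range (x ^ k * z + e) ≤
          Submodule.span K (Set.range ![u (m - 1), f]) := by
        rintro _ ⟨w, rfl⟩
        have h0 : u (m - 1) ∈ Submodule.span K (Set.range ![u (m - 1), f]) :=
          Submodule.subset_span ⟨0, rfl⟩
        have h1 : f ∈ Submodule.span K (Set.range ![u (m - 1), f]) :=
          Submodule.subset_span ⟨1, rfl⟩
        rw [hy]
        simp only [LinearMap.add_apply, LinearMap.smulRight_apply]
        exact add_mem (Submodule.smul_mem _ _ (add_mem (Submodule.smul_mem _ _ h0)
          (Submodule.smul_mem _ _ h1))) (Submodule.smul_mem _ _ (Submodule.smul_mem _ _ h0))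
      rw [hr, pow_one]
      exact (Submodule.finrank_mono hle).trans ((finrank_range_le_card _).trans (by simp))

end HookBasis

theorem Multiset.sum_map_sub_eq (s : Multiset ℕ) (j : ℕ) :
    (s.map (· - j)).sum = (s.map (· - (j + 1))).sum + s.countP (j < ·) := by
  induction s using Multiset.induction_on with
  | empty => simp
  | cons a s ih =>
    simp only [Multiset.map_cons, Multiset.sum_cons, Multiset.countP_cons, ih]
    split_ifs <;> omega

theorem Multiset.le_of_sum_map_sub_eq_zero {s : Multiset ℕ} {j : ℕ}
    (h : (s.map (· - j)).sum = 0) : ∀ p ∈ s, p ≤ j := fun _ hp =>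
  Nat.sub_eq_zero_iff_le.1
    (Multiset.sum_eq_zero_iff.1 h _ (Multiset.mem_map_of_mem (fun q => q - j) hp))

theorem Multiset.countP_zero_lt_eq_card {s : Multiset ℕ} (hpos : ∀ p ∈ s, 0 < p) :
    s.countP (0 < ·) = s.card :=
  Multiset.countP_eq_card.2 hpos

theorem Multiset.one_mem_of_countP_ne_card {s : Multiset ℕ} (hpos : ∀ p ∈ s, 0 < p)
    (h : s.countP (1 < ·) ≠ s.card) : 1 ∈ s := by
  contrapose! h
  refine Multiset.countP_eq_card.2 fun p hp => ?_
  have := hpos p hp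
  have : p ≠ 1 := fun h1 => h (h1 ▸ hp)
  omega

/-- A multiset of positive integers whose truncated sums are those of an almost rectangular
partition of `m` with `k` parts, together with one extra part `1`. -/
theorem Multiset.almost_rectangular_of_sum_map_sub {s : Multiset ℕ} {m k : ℕ}
    (hpos : ∀ p ∈ s, 0 < p) (hsum : s.sum = m + 1) (hkm : k ≤ m)
    (h : ∀ j, 1 ≤ j → (s.map (· - j)).sum = m - j * k) :
    1 ∈ s ∧ ∀ a ∈ s.erase 1, ∀ b ∈ s.erase 1, a ≤ b + 1 := by
  have hcard : s.card = k + 1 := by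
    have h0 := s.sum_map_sub_eq 0
    simp only [Nat.sub_zero, Multiset.map_id', Multiset.countP_zero_lt_eq_card hpos, hsum,
      zero_add, h 1 le_rfl, one_mul] at h0
    omega
  have h1 : 1 ∈ s := by
    refine Multiset.one_mem_of_countP_ne_card hpos ?_
    have := s.sum_map_sub_eq 1
    rw [h 1 le_rfl, h (1 + 1) (by omega)] at this
    omega
  refine ⟨h1, fun a ha b hb => ?_⟩
  by_contra! hab
  have hb0 := hpos b (Multiset.mem_of_mem_erase hb)
  have hpart : 0 < s.countP (b + 1 < ·) :=
    Multiset.countP_pos.2 ⟨a, Multiset.mem_of_mem_erase ha, hab⟩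
  have hb1 := s.sum_map_sub_eq (b + 1)
  have hb2 := s.sum_map_sub_eq b
  rw [h b hb0, h (b + 1) (by omega), add_mul, one_mul] at hb2
  rw [h (b + 1) (by omega), add_mul, one_mul] at hb1
  have hsmall : s.countP (b < ·) + 2 ≤ s.card := by
    rw [← Multiset.cons_erase h1, ← Multiset.cons_erase hb, Multiset.countP_cons_of_neg _ (by omega),
      Multiset.countP_cons_of_neg _ (by omega), Multiset.card_cons, Multiset.card_cons]
    have := Multiset.countP_le_card (b < ·) ((s.erase 1).erase b)
    omega
  omega

theorem Multiset.eq_two_of_sum_map_sub {s : Multiset ℕ} {m k : ℕ}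
    (hpos : ∀ p ∈ s, 0 < p) (hsum : s.sum = m + 1) (hm : m = 2 * k + 1)
    (h1 : (s.map (· - 1)).sum = m - k) (h2 : (s.map (· - 2)).sum = 0) :
    ∀ p ∈ s, p = 2 := by
  have e0 := s.sum_map_sub_eq 0
  have e1 := s.sum_map_sub_eq 1
  simp only [Nat.sub_zero, Multiset.map_id', Multiset.countP_zero_lt_eq_card hpos, hsum,
    zero_add, h1] at e0
  simp only [h1, Nat.reduceAdd, h2] at e1
  intro p hp
  have hle := Multiset.le_of_sum_map_sub_eq_zero h2 p hp
  have hlt := Multiset.countP_eq_card.1 (show s.countP (1 < ·) = s.card by omega) p hp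
  omega

theorem Multiset.three_mem_of_sum_map_sub {s : Multiset ℕ} {m : ℕ}
    (hpos : ∀ p ∈ s, 0 < p) (hsum : s.sum = m + 1) (hm : 2 ≤ m)
    (h1 : 2 * (s.map (· - 1)).sum ≤ m ∨ (s.map (· - 1)).sum ≤ 2)
    (h2 : (s.map (· - 2)).sum = 1) (h3 : (s.map (· - 3)).sum = 0) :
    (3 ∈ s ∧ (∀ p ∈ s.erase 3, p = 1 ∨ p = 2) ∧ 1 ∈ s) ∨ (m = 2 ∧ s = {3}) := by
  have e0 := s.sum_map_sub_eq 0
  have e1 := s.sum_map_sub_eq 1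
  have e2 := s.sum_map_sub_eq 2
  simp only [Nat.sub_zero, Multiset.map_id', Multiset.countP_zero_lt_eq_card hpos, hsum,
    zero_add] at e0
  simp only [Nat.reduceAdd, h2] at e1
  simp only [Nat.reduceAdd, h2, h3] at e2
  obtain ⟨p, hp, hp2⟩ := Multiset.countP_pos.1 (show 0 < s.countP (2 < ·) by omega)
  obtain rfl : p = 3 := le_antisymm (Multiset.le_of_sum_map_sub_eq_zero h3 p hp) hp2
  have hs := Multiset.cons_erase hp
  by_cases h : m = 2 ∧ (s.map (· - 1)).sum = 2
  · refine .inr ⟨h.1, ?_⟩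
    rw [← hs, Multiset.sum_cons, h.1] at hsum
    rw [← hs, Multiset.eq_zero_of_forall_notMem (s := s.erase 3) fun q hq => ?_]
    · rfl
    · have := Multiset.single_le_sum (fun _ _ => Nat.zero_le _) q hq
      have := hpos q (Multiset.mem_of_mem_erase hq)
      omega
  · refine .inl ⟨hp, fun q hq => ?_, Multiset.one_mem_of_countP_ne_card hpos (by omega)⟩
    rw [← hs, Multiset.countP_cons_of_pos _ (by omega)] at e2
    have := Multiset.countP_eq_zero.1 (show (s.erase 3).countP (2 < ·) = 0 by omega) q hq
    have := hpos q (Multiset.mem_of_mem_erase hq)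
    omega

theorem HasJordanPartition.isNilpotent {K : Type*} [Field K] {n : ℕ}
    {M : Matrix (Fin n) (Fin n) K} {mu : Nat.Partition n} (h : HasJordanPartition M mu) :
    IsNilpotent (Matrix.toLin' M) := by
  refine ⟨n, LinearMap.range_eq_bot.1 (Submodule.finrank_eq_zero.1 ?_)⟩
  rw [h.finrank_range_pow, Multiset.sum_eq_zero_iff]
  intro a ha
  obtain ⟨p, hp, rfl⟩ := Multiset.mem_map.1 ha
  exact Nat.sub_eq_zero_of_le (mu.le_of_mem_parts hp)

theorem parts_of_commute {K : Type*} [Field K] {n m : ℕ} (hn : n = m + 1) (hm : 2 ≤ m)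
    {lam ρ : Nat.Partition n} {X Y : Matrix (Fin n) (Fin n) K}
    (hρ : ρ.parts = {m, 1}) (hX : HasJordanPartition X ρ) (hY : HasJordanPartition Y lam)
    (hXY : Commute X Y) :
    (1 ∈ lam.parts ∧
        ∀ a ∈ lam.parts.erase 1, ∀ b ∈ lam.parts.erase 1, a ≤ b + 1) ∨
      (Even n ∧ ∀ p ∈ lam.parts, p = 2) ∨
      (3 ∈ lam.parts ∧ (∀ p ∈ lam.parts.erase 3, p = 1 ∨ p = 2) ∧ 1 ∈ lam.parts) ∨
      (n = 3 ∧ lam.parts = {3}) := by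
  obtain ⟨u, f, φ, ψ, hb⟩ := exists_hookBasis hn hρ hX
  have hx : ∀ j, 1 ≤ j → Module.finrank K (LinearMap.range (Matrix.toLin' X ^ j)) = m - j := by
    intro j hj
    simp [hX.finrank_range_pow, hρ, Nat.sub_eq_zero_of_le hj]
  have hxy : Commute (Matrix.toLin' X) (Matrix.toLin' Y) := hXY.map (Matrix.toLinAlgEquiv' (R := K))
  have hpos : ∀ p ∈ lam.parts, 0 < p := fun p hp => lam.parts_pos hp
  have hsum : lam.parts.sum = m + 1 := lam.parts_sum.trans hn
  obtain ⟨k, -, hkm, h | ⟨hmk, h1, h2⟩ | ⟨h2, h3, h1⟩⟩ :=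
    hb.finrank_range_pow_cases hm hx hxy hY.isNilpotent fun j => (hY.finrank_range_pow j).symm
  · exact .inl (Multiset.almost_rectangular_of_sum_map_sub hpos hsum hkm h)
  · exact .inr (.inl ⟨⟨k + 1, by omega⟩, Multiset.eq_two_of_sum_map_sub hpos hsum hmk h1 h2⟩)
  · obtain h | ⟨rfl, h⟩ := Multiset.three_mem_of_sum_map_sub hpos hsum hm h1 h2 h3
    · exact .inr (.inr (.inl h))
    · exact .inr (.inr (.inr ⟨hn, h⟩))

/-- Let `n ≥ 3` and let `λ` be a partition of `n`.  Over any field,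
`J(n-1,1)` commutes with some conjugate of `J(λ)` if and only if one of the
following holds: (i) `λ` has a part of size `1` and the partition obtained by
removing one such part has largest part exceeding its smallest part by at most
`1`; (ii) `n` is even and all parts of `λ` equal `2`; (iii) `λ` has a part of
size `3`, all its other parts have size `1` or `2`, and it has a part of size
`1`; (iv) `n = 3` and `λ = (3)`. -/
theorem stmt14 {K : Type*} [Field K] {n : ℕ} (hn : 3 ≤ n)
    (lam ρ : Nat.Partition n) (hρ : ρ.parts = {n - 1, 1}) :
    (∃ X Y : Matrix (Fin n) (Fin n) K,
        HasJordanPartition X ρ ∧ HasJordanPartition Y lam ∧ Commute X Y) ↔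
      ((1 ∈ lam.parts ∧
          ∀ a ∈ lam.parts.erase 1, ∀ b ∈ lam.parts.erase 1, a ≤ b + 1) ∨
       (Even n ∧ ∀ p ∈ lam.parts, p = 2) ∨
       (3 ∈ lam.parts ∧ (∀ p ∈ lam.parts.erase 3, p = 1 ∨ p = 2) ∧ 1 ∈ lam.parts) ∨
       (n = 3 ∧ lam.parts = {3})) := by
  have hn' : n = n - 1 + 1 := by omega
  have hm : 2 ≤ n - 1 := by omega
  constructor
  · rintro ⟨X, Y, hX, hY, hXY⟩
    exact parts_of_commute hn' hm hρ hX hY hXY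
  · intro h
    obtain ⟨X, hX⟩ := exists_hasJordanPartition K ρ
    obtain ⟨Y, hY, hXY⟩ := exists_commute_of_parts hn' hm hρ hX h
    exact ⟨X, Y, hX, hY, hXY⟩
end

section
/- Let λ be the partition of 2s with s parts equal to 2, and let μ be any partition of 2s. Then over any field, J(λ) commutes with some conjugate of J(μ). -/
open Polynomial Matrix

/-- The endomorphism `f` is nilpotent with Jordan block sizes `m` (sizes `0` being allowed):
the space is generated under `f` by vectors killed by the powers of `f` with exponents `m`, and
these exponents add up to the dimension. -/
def HasJordanType {K V : Type*} [Field K] [AddCommGroup V] [Module K V]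
    (f : Module.End K V) (m : Multiset ℕ) : Prop :=
  ∃ L : Multiset (ℕ × V), L.map Prod.fst = m ∧ m.sum = Module.finrank K V ∧
    (∀ p ∈ L, (f ^ p.1) p.2 = 0) ∧
    ∀ W : Submodule K V, (∀ x ∈ W, f x ∈ W) → (∀ p ∈ L, p.2 ∈ W) → W = ⊤

namespace HasJordanType

variable {K V V' : Type*} [Field K] [AddCommGroup V] [Module K V] [AddCommGroup V'] [Module K V']

theorem of_zero_cons {f : Module.End K V} {m : Multiset ℕ}
    (h : HasJordanType f (0 ::ₘ m)) : HasJordanType f m := by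
  obtain ⟨L, hL, hs, h0, hW⟩ := h
  obtain ⟨p, L', hp, hp0, hm⟩ : ∃ p L', L = p ::ₘ L' ∧ p.1 = 0 ∧ L'.map Prod.fst = m := by
    have : (0 : ℕ) ∈ L.map Prod.fst := by simp [hL]
    obtain ⟨p, hp, hp0⟩ := Multiset.mem_map.1 this
    obtain ⟨L', rfl⟩ := Multiset.exists_cons_of_mem hp
    refine ⟨p, L', rfl, hp0, ?_⟩
    simpa [hp0] using hL
  subst hp
  refine ⟨L', hm, by simpa using hs, fun q hq => h0 q (Multiset.mem_cons_of_mem hq),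
    fun W hWf hWL => hW W hWf fun q hq => ?_⟩
  rcases Multiset.mem_cons.1 hq with rfl | hq
  · have := h0 q (Multiset.mem_cons_self _ _)
    rw [hp0, pow_zero, Module.End.one_apply] at this
    simp [this]
  · exact hWL q hq

theorem prodMap [Module.Finite K V] [Module.Finite K V'] {f : Module.End K V}
    {g : Module.End K V'} {m n : Multiset ℕ}
    (hf : HasJordanType f m) (hg : HasJordanType g n) :
    HasJordanType (LinearMap.prodMap f g) (m + n) := by
  obtain ⟨L, hL, hs, h0, hW⟩ := hf
  obtain ⟨L', hL', hs', h0', hW'⟩ := hg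
  have hpow : ∀ (k : ℕ) (x : V × V'), ((LinearMap.prodMap f g : Module.End K (V × V')) ^ k) x =
      ((f ^ k) x.1, (g ^ k) x.2) := by
    intro k
    induction k with
    | zero => intro x; simp
    | succ k ih => intro x; simp [pow_succ, Module.End.mul_apply, ih]
  refine ⟨L.map (fun p => (p.1, (p.2, 0))) + L'.map (fun p => (p.1, (0, p.2))), ?_, ?_, ?_, ?_⟩
  · simp [← hL, ← hL', Multiset.map_map]
  · simp [hs, hs']
  · intro p hp
    rw [Multiset.mem_add, Multiset.mem_map, Multiset.mem_map] at hp
    rcases hp with ⟨q, hq, rfl⟩ | ⟨q, hq, rfl⟩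
    · simp [hpow, h0 q hq]
    · simp [hpow, h0' q hq]
  · intro W hWf hWL
    have h1 : W.comap (LinearMap.inl K V V') = ⊤ := hW _
      (fun x hx => by simpa using hWf _ hx)
      (fun p hp => hWL (p.1, (p.2, 0))
        (Multiset.mem_add.2 (Or.inl (Multiset.mem_map_of_mem _ hp))))
    have h2 : W.comap (LinearMap.inr K V V') = ⊤ := hW' _
      (fun x hx => by simpa using hWf _ hx)
      (fun p hp => hWL (p.1, (0, p.2))
        (Multiset.mem_add.2 (Or.inr (Multiset.mem_map_of_mem (fun p => (p.1, ((0 : V), p.2))) hp))))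
    rw [eq_top_iff]
    rintro ⟨x, y⟩ -
    have hx : x ∈ W.comap (LinearMap.inl K V V') := by simp [h1]
    have hy : y ∈ W.comap (LinearMap.inr K V V') := by simp [h2]
    simpa using W.add_mem hx hy

theorem hasJordanPartition [Module.Finite K V] {n : ℕ} {f : Module.End K V}
    {mu : Nat.Partition n} (h : HasJordanType f mu.parts) (b : Module.Basis (Fin n) K V) :
    HasJordanPartition (LinearMap.toMatrix b b f) mu := by
  obtain ⟨L, hL, hs, h0, hW⟩ := h
  induction L using Quot.inductionOn with | _ L
  set d : List ℕ := L.map Prod.fst with hd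
  have hlen : d.length = L.length := by simp [hd]
  let x : Fin d.length → V := fun i => (L.get (i.cast hlen)).2
  have hx0 : ∀ i, (f ^ d.get i) (x i) = 0 := fun i => by
    simpa [hd, x] using h0 (L.get (i.cast hlen)) (List.get_mem _ _)
  let v : ((i : Fin d.length) × Fin (d.get i)) → V := fun p => (f ^ (d.get p.1 - 1 - p.2)) (x p.1)
  have hmem : ∀ i k, (f ^ k) (x i) ∈ Submodule.span K (Set.range v) := by
    intro i k
    by_cases hk : k < d.get i
    · refine Submodule.subset_span ⟨⟨i, ⟨d.get i - 1 - k, by omega⟩⟩, ?_⟩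
      simp only [v]
      congr 2
      omega
    · obtain ⟨l, rfl⟩ := Nat.exists_eq_add_of_le (not_lt.1 hk)
      rw [add_comm, pow_add, Module.End.mul_apply, hx0, map_zero]
      exact zero_mem _
  have hspan : Submodule.span K (Set.range v) = ⊤ := by
    refine hW _ (fun y hy => ?_) (fun p hp => ?_)
    · induction hy using Submodule.span_induction with
      | mem y hy =>
        obtain ⟨p, rfl⟩ := hy
        have := hmem p.1 (d.get p.1 - 1 - p.2 + 1)
        rwa [pow_succ', Module.End.mul_apply] at this
      | zero => simp
      | add y z _ _ hy hz => rw [map_add]; exact add_mem hy hz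
      | smul a y _ hy => rw [map_smul]; exact Submodule.smul_mem _ _ hy
    · obtain ⟨i, rfl⟩ := List.get_of_mem (show p ∈ L from hp)
      simpa [x] using hmem (i.cast hlen.symm) 0
  have hdparts : (↑d : Multiset ℕ) = mu.parts := hL
  have hcard : Fintype.card ((i : Fin d.length) × Fin (d.get i)) = Module.finrank K V := by
    rw [← hs, ← hdparts, Multiset.sum_coe, Fintype.card_sigma]
    simp only [Fintype.card_fin]
    rw [← List.sum_ofFn, List.ofFn_get]
  let c := basisOfTopLeSpanOfCardEqFinrank v hspan.ge hcard
  have hc : ∀ p, c p = v p := fun p => by simp [c]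
  have hmat : LinearMap.toMatrix c c f =
      Matrix.blockDiagonal' fun i => jordanBlock K (d.get i) := by
    ext ⟨i, j⟩ ⟨i', j'⟩
    rw [LinearMap.toMatrix_apply, hc]
    by_cases hj : (j' : ℕ) = 0
    · have h1 : f (v ⟨i', j'⟩) = 0 := by
        have := hx0 i'
        rw [show d.get i' = (d.get i' - 1 - j') + 1 by have := j'.2; omega, pow_succ',
          Module.End.mul_apply] at this
        exact this
      rw [h1, Matrix.blockDiagonal'_apply]
      simp only [map_zero, Finsupp.zero_apply]
      split_ifs with h
      · subst h
        simp [jordanBlock, hj]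
      · rfl
    · have h1 : f (v ⟨i', j'⟩) = c ⟨i', ⟨j' - 1, by omega⟩⟩ := by
        rw [hc]
        simp only [v]
        rw [← Module.End.mul_apply, ← pow_succ']
        congr 2
        have := j'.2
        omega
      rw [h1, c.repr_self, Finsupp.single_apply, Matrix.blockDiagonal'_apply]
      by_cases h : i = i'
      · subst h
        simp only [Sigma.mk.injEq, heq_eq_eq, true_and, dif_pos, cast_eq, jordanBlock,
          Matrix.of_apply, Fin.ext_iff]
        congr 1
        apply propext
        omega
      · rw [dif_neg h, if_neg]
        rintro h'
        exact h (congrArg Sigma.fst h').symm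
  let e := c.indexEquiv b
  let b' := c.reindex e
  refine ⟨d, hL, e, ⟨b.toMatrix b', b'.toMatrix b, b.toMatrix_mul_toMatrix_flip b',
    b'.toMatrix_mul_toMatrix_flip b⟩, ?_⟩
  have h2 : LinearMap.toMatrix b' b' f = Matrix.reindex e e (LinearMap.toMatrix c c f) := by
    ext i j
    simp [b', LinearMap.toMatrix_apply]
  change _ = b.toMatrix b' * _ * b'.toMatrix b
  rw [← hmat, ← h2, basis_toMatrix_mul_linearMap_toMatrix_mul_basis_toMatrix]

end HasJordanType

universe u

/-- There are commuting endomorphisms of some finite-dimensional space, one of Jordan type `m` and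
the other with all Jordan blocks of size `2`. -/
def CommutesWithTwos (K : Type u) [Field K] (m : Multiset ℕ) : Prop :=
  ∃ (V : Type u) (_ : AddCommGroup V) (_ : Module K V) (_ : Module.Finite K V)
    (X Y : Module.End K V) (r : ℕ),
    Commute X Y ∧ HasJordanType X (Multiset.replicate r 2) ∧ HasJordanType Y m

namespace CommutesWithTwos

variable {K : Type u} [Field K]

theorem zero : CommutesWithTwos K 0 :=
  ⟨PUnit, inferInstance, inferInstance, inferInstance, 0, 0, 0, Commute.refl _,
    ⟨0, by simp, by simp [Module.finrank_zero_of_subsingleton], by simp,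
      fun _ _ _ => Subsingleton.elim _ _⟩,
    ⟨0, by simp, by simp [Module.finrank_zero_of_subsingleton], by simp,
      fun _ _ _ => Subsingleton.elim _ _⟩⟩

theorem add {m n : Multiset ℕ} (hm : CommutesWithTwos K m) (hn : CommutesWithTwos K n) :
    CommutesWithTwos K (m + n) := by
  obtain ⟨V, _, _, _, X, Y, r, hc, hX, hY⟩ := hm
  obtain ⟨V', _, _, _, X', Y', r', hc', hX', hY'⟩ := hn
  refine ⟨V × V', inferInstance, inferInstance, inferInstance, LinearMap.prodMap X X',
    LinearMap.prodMap Y Y', r + r', ?_, ?_, hY.prodMap hY'⟩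
  · change _ * _ = _ * _
    rw [LinearMap.prodMap_mul, LinearMap.prodMap_mul, hc.eq, hc'.eq]
  · rw [Multiset.replicate_add]
    exact hX.prodMap hX'

theorem pair (q c : ℕ) : CommutesWithTwos K {q + 2 * c, q} := by
  let B : Module.Basis (Fin (q + 2 * c) ⊕ Fin q) K (Fin (q + 2 * c) ⊕ Fin q → K) := Pi.basisFun K _
  let u : ℕ → (Fin (q + 2 * c) ⊕ Fin q → K) := fun i =>
    if h : i < q + 2 * c then B (Sum.inl ⟨i, h⟩) else 0
  let w : ℕ → (Fin (q + 2 * c) ⊕ Fin q → K) := fun i =>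
    if h : i < q then B (Sum.inr ⟨i, h⟩) else 0
  have hu0 : ∀ i, q + 2 * c ≤ i → u i = 0 := fun i hi => dif_neg (not_lt.2 hi)
  have hw0 : ∀ i, q ≤ i → w i = 0 := fun i hi => dif_neg (not_lt.2 hi)
  have hBu : ∀ i, B (Sum.inl i) = u i := fun i => by simp [u]
  have hBw : ∀ i, B (Sum.inr i) = w i := fun i => by simp [w]
  let X : Module.End K (Fin (q + 2 * c) ⊕ Fin q → K) := B.constr K
    (Sum.elim (fun i => u (i + c) + w i) (fun i => -u (i + 2 * c) - w (i + c)))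
  let Y : Module.End K (Fin (q + 2 * c) ⊕ Fin q → K) := B.constr K
    (Sum.elim (fun i => u (i + 1)) (fun i => w (i + 1)))
  have hXu : ∀ i, X (u i) = u (i + c) + w i := fun i => by
    by_cases h : i < q + 2 * c
    · rw [← hBu ⟨i, h⟩, B.constr_basis, Sum.elim_inl]
    · rw [hu0 i (by omega), hu0 (i + c) (by omega), hw0 i (by omega), map_zero, add_zero]
  have hXw : ∀ i, X (w i) = -u (i + 2 * c) - w (i + c) := fun i => by
    by_cases h : i < q
    · rw [← hBw ⟨i, h⟩, B.constr_basis, Sum.elim_inr]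
    · rw [hw0 i (by omega), hu0 (i + 2 * c) (by omega), hw0 (i + c) (by omega)]
      simp
  have hYu : ∀ i, Y (u i) = u (i + 1) := fun i => by
    by_cases h : i < q + 2 * c
    · rw [← hBu ⟨i, h⟩, B.constr_basis, Sum.elim_inl]
    · rw [hu0 i (by omega), hu0 (i + 1) (by omega), map_zero]
  have hYw : ∀ i, Y (w i) = w (i + 1) := fun i => by
    by_cases h : i < q
    · rw [← hBw ⟨i, h⟩, B.constr_basis, Sum.elim_inr]
    · rw [hw0 i (by omega), hw0 (i + 1) (by omega), map_zero]
  have htop : ∀ W : Submodule K (Fin (q + 2 * c) ⊕ Fin q → K), (∀ i, u i ∈ W) → (∀ i, w i ∈ W) →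
      W = ⊤ := fun W h1 h2 => by
    rw [eq_top_iff, ← B.span_eq, Submodule.span_le]
    rintro _ ⟨i | i, rfl⟩
    · rw [hBu]; exact h1 _
    · rw [hBw]; exact h2 _
  have hYupow : ∀ k, (Y ^ k) (u 0) = u k := fun k => by
    induction k with
    | zero => simp
    | succ k ih => rw [pow_succ', Module.End.mul_apply, ih, hYu]
  have hYwpow : ∀ k, (Y ^ k) (w 0) = w k := fun k => by
    induction k with
    | zero => simp
    | succ k ih => rw [pow_succ', Module.End.mul_apply, ih, hYw]
  refine ⟨_, inferInstance, inferInstance, inferInstance, X, Y, q + c, ?_, ?_, ?_⟩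
  · refine B.ext fun i => ?_
    rcases i with i | i
    · rw [hBu, Module.End.mul_apply, Module.End.mul_apply, hYu, hXu, hXu, map_add, hYu, hYw,
        add_right_comm]
    · rw [hBw, Module.End.mul_apply, Module.End.mul_apply, hYw, hXw, hXw, map_sub, map_neg, hYu,
        hYw, add_right_comm, add_right_comm _ 1 c]
  · refine ⟨(Multiset.range (q + c)).map fun i => (2, u i), ?_, ?_, ?_, ?_⟩
    · simp [Multiset.map_map]
    · simp
      ring
    · intro p hp
      obtain ⟨i, -, rfl⟩ := Multiset.mem_map.1 hp
      rw [pow_two, Module.End.mul_apply, hXu, map_add, hXu, hXw, show i + c + c = i + 2 * c by ring]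
      abel
    · intro W hWf hWL
      have h1 : ∀ i < q + c, u i ∈ W := fun i hi =>
        hWL (2, u i) (Multiset.mem_map_of_mem (fun i => (2, u i)) (Multiset.mem_range.2 hi))
      have h2 : ∀ i < q + c, u (i + c) + w i ∈ W := fun i hi => hXu i ▸ hWf _ (h1 i hi)
      refine htop W (fun i => ?_) (fun i => ?_)
      · by_cases hi : i < q + c
        · exact h1 i hi
        by_cases hi' : i < q + 2 * c
        · have := h2 (i - c) (by omega)
          rwa [hw0 (i - c) (by omega), add_zero, Nat.sub_add_cancel (by omega)] at this
        · rw [hu0 i (by omega)]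
          exact zero_mem _
      · by_cases hi : i < q
        · exact (W.add_mem_iff_right (h1 (i + c) (by omega))).1 (h2 i (by omega))
        · rw [hw0 i (by omega)]
          exact zero_mem _
  · refine ⟨{(q + 2 * c, u 0), (q, w 0)}, by simp, by simp, ?_, ?_⟩
    · simp [hYupow, hYwpow, hu0, hw0]
    · intro W hWf hWL
      have hu : u 0 ∈ W := hWL (q + 2 * c, u 0) (by simp)
      have hw : w 0 ∈ W := hWL (q, w 0) (by simp)
      refine htop W (fun i => ?_) (fun i => ?_)
      · induction i with
        | zero => exact hu
        | succ i ih => exact hYu i ▸ hWf _ ih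
      · induction i with
        | zero => exact hw
        | succ i ih => exact hYw i ▸ hWf _ ih

theorem singleton (c : ℕ) : CommutesWithTwos K {2 * c} := by
  obtain ⟨V, _, _, _, X, Y, r, hc, hX, hY⟩ := pair (K := K) 0 c
  refine ⟨V, _, ‹_›, ‹_›, X, Y, r, hc, hX, HasJordanType.of_zero_cons ?_⟩
  rw [zero_add, Multiset.pair_comm] at hY
  exact hY

theorem of_even_sum (m : Multiset ℕ) (hm : Even m.sum) : CommutesWithTwos K m := by
  induction m using Multiset.strongInductionOn with
  | ih m ih =>
  by_cases hev : ∃ a ∈ m, Even a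
  · obtain ⟨a, ha, hae⟩ := hev
    obtain ⟨m, rfl⟩ := Multiset.exists_cons_of_mem ha
    rw [Multiset.sum_cons, Nat.even_add] at hm
    obtain ⟨c, rfl⟩ := even_iff_two_dvd.1 hae
    rw [← Multiset.singleton_add]
    exact (singleton c).add (ih m (Multiset.lt_cons_self _ _) (hm.1 hae))
  push Not at hev
  rcases m.empty_or_exists_mem with rfl | ⟨a, ha⟩
  · exact zero
  obtain ⟨m, rfl⟩ := Multiset.exists_cons_of_mem ha
  have hao := hev a ha
  rw [Multiset.sum_cons, Nat.even_add] at hm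
  rcases m.empty_or_exists_mem with rfl | ⟨b, hb⟩
  · exact absurd (hm.2 (by simp)) hao
  obtain ⟨m, rfl⟩ := Multiset.exists_cons_of_mem hb
  have hbo := hev b (by simp)
  have hms : Even m.sum := by
    rw [Multiset.sum_cons, Nat.even_add] at hm
    tauto
  have hp : CommutesWithTwos K {a, b} := by
    rw [Nat.not_even_iff] at hao hbo
    rcases le_total b a with h | h
    · have := pair (K := K) b ((a - b) / 2)
      rwa [show b + 2 * ((a - b) / 2) = a by omega] at this
    · have := pair (K := K) a ((b - a) / 2)
      rwa [show a + 2 * ((b - a) / 2) = b by omega, Multiset.pair_comm] at this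
  have := hp.add (ih m ((Multiset.lt_cons_self _ _).trans (Multiset.lt_cons_self _ _)) hms)
  simpa [Multiset.insert_eq_cons] using this

end CommutesWithTwos

/-- Let `λ` be the partition of `2s` with `s` parts equal to `2`, and let `μ`
be any partition of `2s`.  Then over any field `J(λ)` commutes with some
conjugate of `J(μ)`. -/
theorem stmt15 {K : Type*} [Field K] {s : ℕ}
    (lam mu : Nat.Partition (2 * s)) (hlam : lam.parts = Multiset.replicate s 2) :
    ∃ X Y : Matrix (Fin (2 * s)) (Fin (2 * s)) K,
      HasJordanPartition X lam ∧ HasJordanPartition Y mu ∧ Commute X Y := by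
  obtain ⟨V, _, _, _, X, Y, r, hc, hX, hY⟩ :=
    CommutesWithTwos.of_even_sum (K := K) mu.parts (by simp [mu.parts_sum])
  have hn : Module.finrank K V = 2 * s := by
    obtain ⟨_, _, h, _⟩ := hY
    rw [← h, mu.parts_sum]
  have hr : r = s := by
    obtain ⟨_, _, h, _⟩ := hX
    rw [hn, Multiset.sum_replicate, smul_eq_mul] at h
    omega
  let b := Module.finBasisOfFinrankEq K V hn
  rw [hr, ← hlam] at hX
  refine ⟨LinearMap.toMatrix b b X, LinearMap.toMatrix b b Y, hX.hasJordanPartition b,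
    hY.hasJordanPartition b, ?_⟩
  change _ * _ = _ * _
  rw [← LinearMap.toMatrix_mul, ← LinearMap.toMatrix_mul, hc.eq]
end

section
/- Let p be a prime, r ≥ 1, n ≥ 2, and set e = 1 if p = 2 and e = 2 otherwise. Then the nilpotent similarity classes N(n,n) and N(n+1,n−1) commute over F_{p^r} if and only if p(p^{2r}−1)/e does not divide n. -/
open Polynomial Matrix

/-- The Lucas sequence: `u₀ = 0`, `u₁ = 1`, `uₖ₊₂ = b uₖ₊₁ + c uₖ`. -/
def lucasU {R : Type*} [CommRing R] (b c : R) : ℕ → R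
  | 0 => 0
  | 1 => 1
  | k + 2 => b * lucasU b c (k + 1) + c * lucasU b c k

theorem map_lucasU {R S : Type*} [CommRing R] [CommRing S] (φ : R →+* S) (b c : R) (k : ℕ) :
    φ (lucasU b c k) = lucasU (φ b) (φ c) k := by
  induction k using Nat.twoStepInduction with
  | zero => simp [lucasU]
  | one => simp [lucasU]
  | more k h₁ h₂ => simp [lucasU, h₁, h₂]

theorem sub_mul_lucasU {R : Type*} [CommRing R] (a b : R) (k : ℕ) :
    (a - b) * lucasU (a + b) (-(a * b)) k = a ^ k - b ^ k := by
  induction k using Nat.twoStepInduction with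
  | zero => simp [lucasU]
  | one => simp [lucasU]
  | more k h₁ h₂ =>
    rw [lucasU, mul_add, mul_left_comm, h₂, mul_left_comm, h₁]
    ring

theorem lucasU_add_self {R : Type*} [CommRing R] (a : R) (k : ℕ) :
    lucasU (a + a) (-(a * a)) (k + 1) = (k + 1) * a ^ k := by
  induction k using Nat.twoStepInduction with
  | zero => simp [lucasU]
  | one => simp [lucasU]; ring
  | more k h₁ h₂ =>
    rw [lucasU, h₂, h₁]
    push_cast
    ring

/-- The exponent `p (q² - 1) / e` of `PGL₂(q)`, where `q = p ^ r`, is the least common multiple of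
`p`, `q - 1` and `q + 1`. -/
theorem exponent_dvd_iff {p r : ℕ} (hp : p.Prime) (hr : 1 ≤ r) (n : ℕ) :
    p * (p ^ (2 * r) - 1) / (if p = 2 then 1 else 2) ∣ n ↔
      p ∣ n ∧ p ^ r - 1 ∣ n ∧ p ^ r + 1 ∣ n := by
  have hq : 1 ≤ p ^ r := Nat.one_le_pow _ _ hp.pos
  have hpq : p ∣ p ^ r := dvd_pow_self p (by omega)
  obtain ⟨m, hm⟩ : ∃ m, p ^ r = m + 1 := ⟨p ^ r - 1, by omega⟩
  have hsq : p ^ (2 * r) - 1 = m * (m + 2) := by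
    rw [mul_comm, pow_mul, hm]
    apply Nat.sub_eq_of_eq_add
    ring
  have hc1 : Nat.Coprime p m := by
    rw [hm] at hpq
    exact Nat.Coprime.coprime_dvd_left hpq (by simp)
  have hc2 : Nat.Coprime p (m + 2) := by
    rw [hm] at hpq
    exact Nat.Coprime.coprime_dvd_left hpq (Nat.coprime_self_add_right.2 (Nat.coprime_one_right _))
  have hdvd {a b : ℕ} (h : Nat.Coprime a b) : a * b ∣ n ↔ a ∣ n ∧ b ∣ n :=
    ⟨fun hn => ⟨dvd_of_mul_right_dvd hn, dvd_of_mul_left_dvd hn⟩,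
      fun hn => h.mul_dvd_of_dvd_of_dvd hn.1 hn.2⟩
  rw [hsq, hm, Nat.add_sub_cancel, show m + 1 + 1 = m + 2 from rfl]
  split_ifs with h2
  · have hodd : Nat.Coprime m (m + 2) := by
      subst h2
      simpa using hc1.symm
    rw [Nat.div_one, hdvd (hc1.mul_right hc2), hdvd hodd]
  · have hpo : Odd p := hp.odd_of_ne_two h2
    obtain ⟨k, hk⟩ : ∃ k, m = 2 * k := by
      obtain ⟨k, hk⟩ := hpo.pow (n := r)
      exact ⟨k, by omega⟩
    subst hk
    have hck : Nat.Coprime k (k + 1) := by simp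
    have e1 : p * (2 * k * (2 * k + 2)) / 2 = p * (2 * (k * (k + 1))) := by
      apply Nat.div_eq_of_eq_mul_left two_pos
      ring
    have hcp : Nat.Coprime p (2 * (k * (k + 1))) := by
      have : Nat.Coprime p (2 * k * (k + 1)) :=
        hc1.mul_right (Nat.Coprime.coprime_dvd_right ⟨2, by ring⟩ hc2)
      rwa [mul_assoc] at this
    rw [e1, hdvd hcp]
    refine and_congr_right fun _ => ⟨fun h => ⟨dvd_trans ⟨k + 1, by ring⟩ h,
      dvd_trans ⟨k, by ring⟩ h⟩, ?_⟩
    rintro ⟨⟨a, rfl⟩, hb⟩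
    rw [mul_assoc, show 2 * k + 2 = 2 * (k + 1) by ring] at hb
    have hb := Nat.dvd_of_mul_dvd_mul_left two_pos hb
    rw [mul_assoc]
    exact mul_dvd_mul_left 2 (hck.mul_dvd_of_dvd_of_dvd (dvd_mul_right k a) hb)

theorem mem_range_algebraMap_of_pow_card_eq {K L : Type*} [Field K] [Fintype K] [Field L]
    [Algebra K L] {a : L} (ha : a ^ Fintype.card K = a) : a ∈ (algebraMap K L).range := by
  have h0 := FiniteField.X_pow_card_sub_X_ne_zero K (Fintype.one_lt_card (α := K))
  have hs : (X ^ Fintype.card K - X : K[X]).Splits := by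
    rw [splits_iff_card_roots, FiniteField.roots_X_pow_card_sub_X,
      FiniteField.X_pow_card_sub_X_natDegree_eq K Fintype.one_lt_card]
    rfl
  exact hs.mem_range_of_isRoot h0 (by simp [ha])

theorem lucasU_eq_zero {K : Type*} [Field K] [Fintype K] {p n : ℕ} [CharP K p] (hp : p ∣ n)
    (h1 : Fintype.card K - 1 ∣ n) (h2 : Fintype.card K + 1 ∣ n) (b c : K) (hc : c ≠ 0) :
    lucasU b c n = 0 := by
  set q := Fintype.card K with hq
  let L := AlgebraicClosure K
  let φ := algebraMap K L
  apply φ.injective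
  rw [map_zero, map_lucasU]
  obtain ⟨s, hs⟩ : ∃ s : L, (X ^ 2 - C (φ b) * X - C (φ c)).IsRoot s := by
    apply IsAlgClosed.exists_root
    have : (X ^ 2 - C (φ b) * X - C (φ c)).degree = 2 := by compute_degree!
    simp [this]
  set t := φ b - s with ht
  have hs' : s ^ 2 - φ b * s - φ c = 0 := by simpa using hs
  have hb : φ b = s + t := by rw [ht]; ring
  have hcc : φ c = -(s * t) := by rw [ht]; linear_combination -hs'
  have hφc : φ c ≠ 0 := by simpa using hc
  have hs0 : s ≠ 0 := by rintro h; simp [hcc, h] at hφc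
  have ht0 : t ≠ 0 := by rintro h; simp [hcc, h] at hφc
  rw [hb, hcc]
  by_cases hst : s = t
  · rw [← hst]
    rcases n with _ | k
    · simp [lucasU]
    have : CharP L p := charP_of_injective_algebraMap φ.injective p
    rw [lucasU_add_self, ← Nat.cast_one, ← Nat.cast_add, (CharP.cast_eq_zero_iff L p _).2 hp,
      zero_mul]
  have key : s ^ n = t ^ n → lucasU (s + t) (-(s * t)) n = 0 := by
    intro h
    have := sub_mul_lucasU s t n
    rw [h, sub_self, mul_eq_zero, sub_eq_zero] at this
    exact this.resolve_left hst
  apply key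
  have hfrob : ∀ x y : L, (x - y) ^ q = x ^ q - y ^ q := by
    intro x y
    exact map_sub (FiniteField.frobeniusAlgHom K L) x y
  have hfix : ∀ x : K, φ x ^ q = φ x := by
    intro x
    rw [← map_pow, FiniteField.pow_card]
  have hq0 : 0 < q := Fintype.card_pos
  have hsq : s ^ q = s ∨ s ^ q = t := by
    have h3 : (s ^ q) ^ 2 - φ b * s ^ q - φ c = 0 := by
      rw [← pow_mul, mul_comm q, pow_mul, ← hfix b, ← hfix c, ← mul_pow, ← hfrob, ← hfrob, hs',
        zero_pow hq0.ne']
    have h4 : (s ^ q - s) * (s ^ q - t) = 0 := by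
      rw [hb, hcc] at h3
      linear_combination h3
    rcases mul_eq_zero.1 h4 with h | h
    · exact .inl (sub_eq_zero.1 h)
    · exact .inr (sub_eq_zero.1 h)
  have htq : t ^ q = φ b - s ^ q := by rw [ht, hfrob, hfix]
  rcases hsq with h | h
  · rw [h, ← ht] at htq
    have hx : ∀ x : L, x ≠ 0 → x ^ q = x → x ^ n = 1 := by
      intro x hx hxq
      have : x ^ (q - 1) = 1 := by
        apply mul_right_cancel₀ hx
        rw [← pow_succ, Nat.sub_add_cancel hq0, hxq, one_mul]
      obtain ⟨m, rfl⟩ := h1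
      rw [pow_mul, this, one_pow]
    rw [hx s hs0 h, hx t ht0 htq]
  · rw [h, show φ b - t = s by rw [ht]; ring] at htq
    have h3 : s ^ (q + 1) = t ^ (q + 1) := by rw [pow_succ, pow_succ, h, htq, mul_comm]
    obtain ⟨m, rfl⟩ := h2
    rw [pow_mul, pow_mul, h3]

theorem exists_lucasU_ne_zero {K : Type*} [Field K] [Fintype K] {p n : ℕ} [CharP K p]
    (h : ¬ (p ∣ n ∧ Fintype.card K - 1 ∣ n ∧ Fintype.card K + 1 ∣ n)) :
    ∃ b c : K, c ≠ 0 ∧ lucasU b c n ≠ 0 := by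
  set q := Fintype.card K with hq
  have hq1 : 1 < q := Fintype.one_lt_card
  by_cases hp : p ∣ n
  swap
  · refine ⟨1 + 1, -(1 * 1), by simp, ?_⟩
    rcases n with _ | k
    · simp at hp
    rw [lucasU_add_self, one_pow, mul_one]
    rw [← CharP.cast_eq_zero_iff K] at hp
    exact_mod_cast hp
  by_cases h1 : q - 1 ∣ n
  swap
  · obtain ⟨g, hg⟩ := IsCyclic.exists_generator (α := Kˣ)
    refine ⟨g + 1, -(g * 1), by simp, fun h0 => h1 ?_⟩
    have := sub_mul_lucasU (g : K) 1 n
    rw [h0, mul_zero, one_pow, eq_comm, sub_eq_zero] at this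
    rw [hq, ← Nat.card_eq_fintype_card, ← Nat.card_units, ← orderOf_eq_card_of_forall_mem_zpowers hg]
    apply orderOf_dvd_of_pow_eq_one
    ext
    simpa using this
  have h2 : ¬ q + 1 ∣ n := fun h2 => h ⟨hp, h1, h2⟩
  let L := AlgebraicClosure K
  let φ := algebraMap K L
  have hq2 : q ^ 2 - 1 = (q - 1) * (q + 1) := by
    obtain ⟨m, hm⟩ : ∃ m, q = m + 1 := ⟨q - 1, by omega⟩
    rw [hm, Nat.add_sub_cancel]
    apply Nat.sub_eq_of_eq_add
    ring
  have hne : NeZero ((q ^ 2 - 1 : ℕ) : L) := by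
    refine ⟨?_⟩
    have hK0 : (q : L) = 0 := by
      have : (q : K) = 0 := by simp [hq]
      rw [← map_natCast φ, this, map_zero]
    rw [Nat.cast_sub (Nat.one_le_pow _ _ (by omega))]
    simp [hK0]
  obtain ⟨a, ha⟩ := HasEnoughRootsOfUnity.exists_primitiveRoot L (q ^ 2 - 1)
  have haq : a ^ (q ^ 2) = a := by
    rw [← Nat.sub_add_cancel (Nat.one_le_pow 2 q (by omega)), pow_succ, ha.pow_eq_one, one_mul]
  have ha0 : a ≠ 0 := ha.ne_zero (by rw [hq2]; exact Nat.mul_ne_zero (by omega) (by omega))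
  obtain ⟨b, hb⟩ : a + a ^ q ∈ φ.range := by
    apply mem_range_algebraMap_of_pow_card_eq
    have := map_add (FiniteField.frobeniusAlgHom K L) a (a ^ q)
    simp only [FiniteField.coe_frobeniusAlgHom] at this
    rw [this, ← hq, ← pow_mul, ← sq, haq, add_comm]
  obtain ⟨c, hc⟩ : -(a * a ^ q) ∈ φ.range := by
    rw [neg_mem_iff]
    apply mem_range_algebraMap_of_pow_card_eq
    rw [mul_pow, ← hq, ← pow_mul, ← sq, haq, mul_comm]
  refine ⟨b, c, ?_, fun h0 => h2 ?_⟩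
  · rintro rfl
    simp [ha0] at hc
  · have h3 := sub_mul_lucasU a (a ^ q) n
    rw [← hb, ← hc, ← map_lucasU, h0, map_zero, mul_zero, eq_comm, sub_eq_zero] at h3
    have h4 : a ^ ((q - 1) * n) = 1 := by
      apply mul_right_cancel₀ (pow_ne_zero n ha0)
      rw [← pow_add, one_mul, h3, ← pow_mul]
      congr 1
      obtain ⟨m, hm⟩ : ∃ m, q = m + 1 := ⟨q - 1, by omega⟩
      rw [hm, Nat.add_sub_cancel]
      ring
    have h5 := ha.dvd_of_pow_eq_one _ h4
    rw [hq2] at h5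
    exact Nat.dvd_of_mul_dvd_mul_left (by omega) h5

theorem isUnit_algebraMap_add {K A : Type*} [Field K] [CommRing A] [Algebra K A] {c : K}
    (hc : c ≠ 0) {a : A} (ha : IsNilpotent a) : IsUnit (algebraMap K A c + a) :=
  ha.isUnit_add_left_of_commute ((IsUnit.mk0 c hc).map (algebraMap K A)) (Commute.all _ _)

theorem aeval_eq_mul_divX_add {K A : Type*} [Field K] [CommRing A] [Algebra K A] (x : A)
    (f : K[X]) : aeval x f = x * aeval x f.divX + algebraMap K A (f.coeff 0) := by
  conv_lhs => rw [← divX_mul_X_add f, map_add, map_mul, aeval_X, aeval_C, mul_comm]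

theorem finrank_ker_pow_le {K V : Type*} [Field K] [AddCommGroup V] [Module K V]
    [FiniteDimensional K V] (f : Module.End K V) (k : ℕ) :
    Module.finrank K (LinearMap.ker (f ^ k)) ≤ k * Module.finrank K (LinearMap.ker f) := by
  induction k with
  | zero => simp [LinearMap.ker_eq_bot.2 (fun _ _ h => h : Function.Injective (1 : Module.End K V))]
  | succ k ih =>
    have h := LinearMap.finrank_range_add_finrank_ker
      (f.domRestrict (LinearMap.ker (f ^ (k + 1))))
    have h1 : Module.finrank K (LinearMap.range (f.domRestrict (LinearMap.ker (f ^ (k + 1))))) ≤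
        Module.finrank K (LinearMap.ker (f ^ k)) := by
      apply Submodule.finrank_mono
      rintro _ ⟨⟨z, hz⟩, rfl⟩
      simpa [pow_succ] using hz
    have h2 : Module.finrank K (LinearMap.ker (f.domRestrict (LinearMap.ker (f ^ (k + 1))))) ≤
        Module.finrank K (LinearMap.ker f) := by
      rw [← LinearMap.finrank_range_of_inj (f := (LinearMap.ker (f ^ (k + 1))).subtype ∘ₗ
        (LinearMap.ker (f.domRestrict (LinearMap.ker (f ^ (k + 1))))).subtype)
        (Subtype.val_injective.comp Subtype.val_injective)]
      apply Submodule.finrank_mono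
      rintro _ ⟨⟨z, hz⟩, rfl⟩
      simpa using hz
    rw [add_mul, one_mul]
    omega

theorem pow_succ_eq_lucasU {A : Type*} [CommRing A] {x y b c : A}
    (h : y ^ 2 = c * x ^ 2 + b * x * y) (k : ℕ) :
    y ^ (k + 1) = lucasU b c (k + 1) * x ^ k * y + c * lucasU b c k * x ^ (k + 1) := by
  induction k with
  | zero => simp [lucasU]
  | succ k ih =>
    rw [pow_succ, ih, lucasU]
    linear_combination (lucasU b c (k + 1) * x ^ k) * h

theorem exists_lucasU_ne_zero_of_commuting {K V A : Type*} [Field K] [AddCommGroup V] [Module K V]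
    [FiniteDimensional K V] [CommRing A] [Algebra K A] [Module A V] [IsScalarTower K A V]
    [FaithfulSMul A V] {n : ℕ} (hn : 3 ≤ n) {x y : A} (hV : Module.finrank K V = 2 * n)
    (hx : x ^ n = 0) (hy : y ^ n ≠ 0) (hy' : IsNilpotent y)
    (hkx : Module.finrank K (LinearMap.ker (Algebra.lsmul K K V x)) = 2)
    (hky : Module.finrank K (LinearMap.ker (Algebra.lsmul K K V y)) = 2) :
    ∃ b c : K, c ≠ 0 ∧ lucasU b c n ≠ 0 := by
  have hx' : IsNilpotent x := ⟨n, hx⟩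
  have hrx := LinearMap.finrank_range_add_finrank_ker (Algebra.lsmul K K V x)
  have hry := LinearMap.finrank_range_add_finrank_ker (Algebra.lsmul K K V y)
  set W := LinearMap.range (Algebra.lsmul K K V x) with hW
  have memW : ∀ z, z ∈ W ↔ ∃ w, x • w = z := fun z => by simp [hW]
  have smulW : ∀ (a : A) z, z ∈ W → a • z ∈ W := by
    intro a z hz
    obtain ⟨w, rfl⟩ := (memW z).1 hz
    exact (memW _).2 ⟨a • w, smul_comm _ _ _⟩
  have unitW : ∀ {a : A} {z : V}, IsUnit a → a • z ∈ W → z ∈ W := by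
    rintro _ z ⟨a, rfl⟩ hz
    have := smulW (↑a⁻¹ : A) _ hz
    rwa [← mul_smul, Units.inv_mul, one_smul] at this
  have faithful : ∀ a : A, (∀ z : V, a • z = 0) → a = 0 := fun a ha =>
    FaithfulSMul.eq_of_smul_eq_smul (α := V) fun z => by rw [ha, zero_smul]
  -- a vector `v` such that `v` and `y v` are independent modulo the range of `x`
  obtain ⟨v, hv⟩ : ∃ v, y • v ∉ W := by
    by_contra! hcon
    have hk : ∀ k : ℕ, ∀ z : V, ∃ w, x ^ k • w = y ^ k • z := by
      intro k
      induction k with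
      | zero => exact fun z => ⟨z, by simp⟩
      | succ k ih =>
        intro z
        obtain ⟨w, hw⟩ := ih z
        obtain ⟨w', hw'⟩ := (memW _).1 (hcon w)
        exact ⟨w', by rw [pow_succ, mul_smul, hw', smul_comm, hw, ← mul_smul, ← pow_succ']⟩
    refine hy (faithful _ fun z => ?_)
    obtain ⟨w, hw⟩ := hk n z
    rw [← hw, hx, zero_smul]
  have hvW : v ∉ W := fun h => hv (smulW y v h)
  have indep : ∀ α δ : K, α • v + δ • y • v ∈ W → α = 0 ∧ δ = 0 := by
    intro α δ h
    have hα : α = 0 := by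
      by_contra hα
      refine hvW (unitW (isUnit_algebraMap_add hα (hy'.smul δ)) ?_)
      rwa [add_smul, algebraMap_smul, smul_assoc]
    subst hα
    refine ⟨rfl, ?_⟩
    by_contra hδ
    rw [zero_smul, zero_add] at h
    exact hv ((Submodule.smul_mem_iff _ hδ).1 h)
  have decomp : ∀ z : V, ∃ (α δ : K) (w : V), z = α • v + δ • y • v + x • w := by
    have hli : LinearIndependent K ![v, y • v] :=
      LinearIndependent.pair_iff.2 fun α δ h => indep α δ (h ▸ W.zero_mem)
    have hU : Module.finrank K (Submodule.span K {v, y • v}) = 2 := by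
      rw [← Matrix.range_cons_cons_empty, finrank_span_eq_card hli, Fintype.card_fin]
    have hinf : W ⊓ Submodule.span K {v, y • v} = ⊥ := by
      rw [Submodule.eq_bot_iff]
      rintro z ⟨hz, hz'⟩
      obtain ⟨α, δ, rfl⟩ := Submodule.mem_span_pair.1 hz'
      obtain ⟨rfl, rfl⟩ := indep α δ hz
      simp
    have hsup : W ⊔ Submodule.span K {v, y • v} = ⊤ := by
      apply Submodule.eq_top_of_finrank_eq
      have := Submodule.finrank_sup_add_finrank_inf_eq W (Submodule.span K {v, y • v})
      rw [hinf, finrank_bot] at this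
      omega
    intro z
    obtain ⟨w, hw, u, hu, rfl⟩ := Submodule.mem_sup.1 (hsup ▸ Submodule.mem_top : z ∈ _)
    obtain ⟨α, δ, rfl⟩ := Submodule.mem_span_pair.1 hu
    obtain ⟨w, rfl⟩ := (memW w).1 hw
    exact ⟨α, δ, w, add_comm _ _⟩
  have gen : ∀ z : V, ∃ f g : K[X], z = aeval x f • v + aeval x g • y • v := by
    have hk : ∀ (k : ℕ) (z : V), ∃ (f g : K[X]) (w : V),
        z = aeval x f • v + aeval x g • y • v + x ^ k • w := by
      intro k
      induction k with
      | zero => exact fun z => ⟨0, 0, z, by simp⟩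
      | succ k ih =>
        intro z
        obtain ⟨f, g, w, rfl⟩ := ih z
        obtain ⟨α, δ, w', rfl⟩ := decomp w
        refine ⟨f + C α * X ^ k, g + C δ * X ^ k, w', ?_⟩
        simp only [map_add, map_mul, aeval_C, aeval_X, map_pow, add_smul, smul_add, mul_smul,
          algebraMap_smul, pow_succ, smul_comm (x ^ k)]
        abel
    intro z
    obtain ⟨f, g, w, hw⟩ := hk n z
    exact ⟨f, g, by rw [hw, hx, zero_smul, add_zero]⟩
  -- the quadratic relation satisfied by `y`
  obtain ⟨f, g, hfg⟩ := gen (y ^ 2 • v)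
  obtain ⟨hf0, hg0⟩ : f.coeff 0 = 0 ∧ g.coeff 0 = 0 := by
    have h1 : (y ^ 2 - algebraMap K A (f.coeff 0) - algebraMap K A (g.coeff 0) * y) • v ∈ W := by
      refine (memW _).2 ⟨aeval x f.divX • v + aeval x g.divX • y • v, ?_⟩
      rw [sub_smul, sub_smul, hfg, aeval_eq_mul_divX_add x f, aeval_eq_mul_divX_add x g]
      module
    have hf0 : f.coeff 0 = 0 := by
      by_contra hf0
      refine hvW (unitW (isUnit_algebraMap_add (neg_ne_zero.2 hf0)
        (a := (y - algebraMap K A (g.coeff 0)) * y) ?_) ?_)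
      · exact (Commute.all _ _).isNilpotent_mul_left hy'
      · convert h1 using 2
        rw [map_neg]
        ring
    refine ⟨hf0, ?_⟩
    by_contra hg0
    refine hv (unitW (isUnit_algebraMap_add (neg_ne_zero.2 hg0) hy') ?_)
    rw [← mul_smul]
    convert h1 using 2
    rw [hf0, map_neg, map_zero]
    ring
  set F := aeval x f.divX with hF
  set G := aeval x g.divX with hG
  have hfF : aeval x f = x * F := by rw [aeval_eq_mul_divX_add, hf0, map_zero, add_zero]
  have hgG : aeval x g = x * G := by rw [aeval_eq_mul_divX_add, hg0, map_zero, add_zero]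
  have quad : y ^ 2 = x * F + x * G * y := by
    rw [← sub_eq_zero]
    refine faithful _ fun z => ?_
    have h0 : (y ^ 2 - (x * F + x * G * y)) • v = 0 := by
      rw [sub_smul, hfg, hfF, hgG]
      module
    obtain ⟨p, q, rfl⟩ := gen z
    rw [smul_add, smul_comm, h0, smul_comm, smul_comm _ y v, h0]
    simp
  have hF0 : f.divX.coeff 0 = 0 := by
    by_contra hF0
    have hFu : IsUnit F := by
      rw [hF, aeval_eq_mul_divX_add, add_comm]
      exact isUnit_algebraMap_add hF0 ((Commute.all _ _).isNilpotent_mul_right hx')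
    obtain ⟨F', hF'⟩ := hFu.exists_right_inv
    have hle : W ≤ LinearMap.range (Algebra.lsmul K K V y) := by
      intro z hz
      obtain ⟨w, rfl⟩ := (memW z).1 hz
      refine ⟨(F' * (y - x * G)) • w, ?_⟩
      change y • (F' * (y - x * G)) • w = x • w
      rw [← mul_smul]
      congr 1
      linear_combination F' * quad + x * hF'
    have heq := Submodule.eq_of_le_of_finrank_eq hle (by omega)
    exact hv (heq ▸ ⟨v, rfl⟩)
  set F₁ := aeval x f.divX.divX with hF₁
  have hFF₁ : F = x * F₁ := by rw [hF, aeval_eq_mul_divX_add, hF0, map_zero, add_zero]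
  have quad' : y ^ 2 = F₁ * x ^ 2 + G * x * y := by
    rw [quad, hFF₁]
    ring
  refine ⟨g.divX.coeff 0, f.divX.divX.coeff 0, fun hc => ?_, fun hu => hy ?_⟩
  · set F₂ := aeval x f.divX.divX.divX with hF₂
    have hFF₂ : F₁ = x * F₂ := by rw [hF₁, aeval_eq_mul_divX_add, hc, map_zero, add_zero]
    obtain ⟨k, rfl⟩ : ∃ k, n = k + 3 := ⟨n - 3, by omega⟩
    have htop : x ^ (k + 2) • y • v ≠ 0 := by
      intro h0
      have hle : W ≤ LinearMap.ker ((Algebra.lsmul K K V x) ^ (k + 2)) := by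
        intro z hz
        obtain ⟨w, rfl⟩ := (memW z).1 hz
        rw [LinearMap.mem_ker, ← map_pow]
        change x ^ (k + 2) • x • w = 0
        rw [← mul_smul, ← pow_succ, hx, zero_smul]
      have hle' := finrank_ker_pow_le (Algebra.lsmul K K V x) (k + 2)
      rw [hkx] at hle' hrx
      have heq := Submodule.eq_of_le_of_finrank_le hle (by omega)
      apply hv
      rw [heq, LinearMap.mem_ker, ← map_pow]
      exact h0
    have hxk : ∀ j, k + 3 ≤ j → x ^ j = 0 := fun j hj => pow_eq_zero_of_le hj hx
    set m := (y - x * G) • v with hm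
    have hm2 : x ^ (k + 2) • m ≠ 0 := by
      rwa [hm, ← mul_smul, show x ^ (k + 2) * (y - x * G) = x ^ (k + 2) * y by
        linear_combination (-G) * hx, mul_smul]
    have hker : ∀ j, k ≤ j → y • x ^ j • m = 0 := by
      intro j hj
      obtain ⟨i, rfl⟩ := Nat.exists_eq_add_of_le hj
      rw [hm, ← mul_smul, ← mul_smul, show y * x ^ (k + i) * (y - x * G) = 0 by
        rw [hFF₂] at quad'
        linear_combination x ^ (k + i) * quad' + F₂ * x ^ i * hx, zero_smul]
    have hli : LinearIndependent K ![x ^ k • m, x ^ (k + 1) • m, x ^ (k + 2) • m] := by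
      rw [Fintype.linearIndependent_iff]
      intro c hc
      simp only [Fin.sum_univ_three, Matrix.cons_val] at hc
      have push : ∀ i : ℕ, c 0 • x ^ (k + i) • m + c 1 • x ^ (k + 1 + i) • m +
          c 2 • x ^ (k + 2 + i) • m = 0 := by
        intro i
        have := congrArg (x ^ i • ·) hc
        simpa only [smul_add, smul_zero, smul_comm (x ^ i) (_ : K), ← mul_smul (x ^ i),
          ← pow_add, add_comm i] using this
      have h0 : c 0 = 0 := by
        have := push 2
        rw [hxk (k + 1 + 2) (by omega), hxk (k + 2 + 2) (by omega)] at this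
        simpa [hm2] using this
      have h1 : c 1 = 0 := by
        have := push 1
        rw [h0, hxk (k + 2 + 1) (by omega)] at this
        simpa [hm2] using this
      have h2 : c 2 = 0 := by
        have := push 0
        rw [h0, h1] at this
        simpa [hm2] using this
      intro i
      fin_cases i <;> assumption
    have hle : Submodule.span K (Set.range ![x ^ k • m, x ^ (k + 1) • m, x ^ (k + 2) • m]) ≤
        LinearMap.ker (Algebra.lsmul K K V y) := by
      rw [Submodule.span_le]
      rintro _ ⟨i, rfl⟩
      fin_cases i
      · exact hker k le_rfl
      · exact hker (k + 1) (by omega)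
      · exact hker (k + 2) (by omega)
    have := Submodule.finrank_mono hle
    rw [finrank_span_eq_card hli, hky] at this
    simp at this
  · obtain ⟨k, rfl⟩ : ∃ k, n = k + 1 := ⟨n - 1, by omega⟩
    have hcoe : (lucasU g.divX f.divX.divX (k + 1)).coeff 0 = 0 := by
      rw [← hu]
      simp only [coeff_zero_eq_eval_zero]
      exact map_lucasU (evalRingHom (0 : K)) _ _ _
    have hU : lucasU G F₁ (k + 1) = x * aeval x (lucasU g.divX f.divX.divX (k + 1)).divX := by
      rw [hG, hF₁]
      have := map_lucasU (aeval x : K[X] →ₐ[K] A).toRingHom g.divX f.divX.divX (k + 1)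
      refine this.symm.trans ?_
      refine (aeval_eq_mul_divX_add x _).trans ?_
      rw [hcoe, map_zero, add_zero]
    rw [pow_succ_eq_lucasU quad' k, hU, hx]
    linear_combination (aeval x (lucasU g.divX f.divX.divX (k + 1)).divX) * y * hx

theorem jordanBlock_pow_apply {K : Type*} [Field K] (p k : ℕ) (i j : Fin p) :
    (jordanBlock K p ^ k) i j = if (i : ℕ) + k = j then 1 else 0 := by
  induction k generalizing i j with
  | zero => simp [Matrix.one_apply, Fin.ext_iff]
  | succ k ih =>
    simp only [pow_succ, Matrix.mul_apply, ih, ite_mul, one_mul, zero_mul]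
    by_cases h : (i : ℕ) + k < p
    · rw [Finset.sum_eq_single ⟨i + k, h⟩]
      · simp [jordanBlock, add_assoc]
      · intro b _ hb
        rw [if_neg]
        rintro h'
        exact hb (Fin.ext h'.symm)
      · simp
    · rw [Finset.sum_eq_zero, if_neg (by omega)]
      intro b _
      rw [if_neg (by omega)]

theorem jordanBlock_pow_eq_zero_iff {K : Type*} [Field K] {p k : ℕ} :
    jordanBlock K p ^ k = 0 ↔ p ≤ k := by
  constructor
  · intro h
    by_contra! hk
    have := congrFun (congrFun h ⟨0, by omega⟩) ⟨k, hk⟩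
    simp [jordanBlock_pow_apply] at this
  · intro h
    ext i j
    rw [jordanBlock_pow_apply, if_neg (by omega), Matrix.zero_apply]

theorem jordanBlock_mulVec {K : Type*} [Field K] {p : ℕ} (v : Fin p → K) (i : Fin p) :
    (jordanBlock K p).mulVec v i = if h : (i : ℕ) + 1 < p then v ⟨i + 1, h⟩ else 0 := by
  simp only [Matrix.mulVec, dotProduct, jordanBlock, Matrix.of_apply, ite_mul, one_mul, zero_mul]
  split_ifs with h
  · rw [Finset.sum_eq_single ⟨i + 1, h⟩]
    · simp
    · intro b _ hb
      rw [if_neg]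
      rintro h'
      exact hb (Fin.ext h'.symm)
    · simp
  · exact Finset.sum_eq_zero fun b _ => if_neg (by omega)

theorem SimilarMat.pow_eq_zero_iff {m K : Type*} [Fintype m] [DecidableEq m] [CommRing K]
    {A B : Matrix m m K} (h : SimilarMat A B) (k : ℕ) : B ^ k = 0 ↔ A ^ k = 0 := by
  obtain ⟨P, rfl⟩ := h
  rw [Units.conj_pow, Units.mul_left_eq_zero, Units.mul_right_eq_zero]

theorem SimilarMat.rank_eq {m K : Type*} [Fintype m] [DecidableEq m] [CommRing K]
    {A B : Matrix m m K} (h : SimilarMat A B) : B.rank = A.rank := by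
  obtain ⟨P, rfl⟩ := h
  rw [Matrix.rank_mul_eq_left_of_isUnit_det _ _ ((Matrix.isUnit_iff_isUnit_det _).1 P⁻¹.isUnit),
    Matrix.rank_mul_eq_right_of_isUnit_det _ _ ((Matrix.isUnit_iff_isUnit_det _).1 P.isUnit)]

theorem reindex_pow_eq_zero_iff {m m' K : Type*} [Fintype m] [Fintype m'] [DecidableEq m]
    [DecidableEq m'] [CommRing K] (e : m ≃ m') (A : Matrix m m K) (k : ℕ) :
    (Matrix.reindex e e A) ^ k = 0 ↔ A ^ k = 0 := by
  rw [← Matrix.coe_reindexAlgEquiv K, ← map_pow, EmbeddingLike.map_eq_zero_iff]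

theorem blockDiagonal'_eq_zero_iff {o K : Type*} [DecidableEq o] [Zero K] {m : o → Type*}
    {A : ∀ i, Matrix (m i) (m i) K} : Matrix.blockDiagonal' A = 0 ↔ ∀ i, A i = 0 := by
  refine ⟨fun h i => ?_, fun h => ?_⟩
  · ext a b
    simpa using congrFun (congrFun h ⟨i, a⟩) ⟨i, b⟩
  · rw [show A = 0 from funext h, Matrix.blockDiagonal'_zero]

theorem HasJordanPartition.pow_eq_zero_iff {K : Type*} [Field K] {N : ℕ}
    {M : Matrix (Fin N) (Fin N) K} {mu : Nat.Partition N} (h : HasJordanPartition M mu) (k : ℕ) :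
    M ^ k = 0 ↔ ∀ i ∈ mu.parts, i ≤ k := by
  obtain ⟨L, hL, e, hs⟩ := h
  rw [hs.pow_eq_zero_iff, reindex_pow_eq_zero_iff, ← Matrix.blockDiagonal'_pow,
    blockDiagonal'_eq_zero_iff, ← hL]
  simp only [Pi.pow_apply, jordanBlock_pow_eq_zero_iff, Multiset.mem_coe]
  rw [List.forall_mem_iff_get]

theorem finrank_ker_blockDiagonal'_jordanBlock {K : Type*} [Field K] {L : List ℕ}
    (hL : ∀ i, 0 < L.get i) :
    Module.finrank K (LinearMap.ker
      (Matrix.blockDiagonal' fun i => jordanBlock K (L.get i)).mulVecLin) = L.length := by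
  have hmul : ∀ (v : ((i : Fin L.length) × Fin (L.get i)) → K) i j,
      (Matrix.blockDiagonal' fun i => jordanBlock K (L.get i)).mulVec v ⟨i, j⟩ =
        (jordanBlock K (L.get i)).mulVec (fun j => v ⟨i, j⟩) j := by
    intro v i j
    simp only [Matrix.mulVec, dotProduct, Fintype.sum_sigma]
    rw [Finset.sum_eq_single i]
    · simp
    · intro b _ hb
      simp [Matrix.blockDiagonal'_apply_ne _ _ _ hb.symm]
    · simp
  let f : LinearMap.ker (Matrix.blockDiagonal' fun i => jordanBlock K (L.get i)).mulVecLin →ₗ[K]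
      (Fin L.length → K) :=
    LinearMap.pi fun i => (LinearMap.proj ⟨i, ⟨0, hL i⟩⟩) ∘ₗ Submodule.subtype _
  have hf : Function.Bijective f := by
    constructor
    · rw [injective_iff_map_eq_zero]
      rintro ⟨v, hv⟩ h
      ext ⟨i, j, hj⟩
      rcases j with _ | j
      · exact congrFun h i
      · have := congrFun (LinearMap.mem_ker.1 hv) ⟨i, j, by omega⟩
        rw [Matrix.mulVecLin_apply, hmul, jordanBlock_mulVec, dif_pos hj] at this
        exact this
    · intro w
      refine ⟨⟨fun s => if (s.2 : ℕ) = 0 then w s.1 else 0, ?_⟩, ?_⟩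
      · rw [LinearMap.mem_ker]
        ext ⟨i, j⟩
        rw [Matrix.mulVecLin_apply, hmul, jordanBlock_mulVec]
        simp
      · ext i
        simp [f]
  rw [(LinearEquiv.ofBijective f hf).finrank_eq]
  simp

theorem HasJordanPartition.finrank_ker {K : Type*} [Field K] {N : ℕ}
    {M : Matrix (Fin N) (Fin N) K} {mu : Nat.Partition N} (h : HasJordanPartition M mu) :
    Module.finrank K (LinearMap.ker M.mulVecLin) = mu.parts.card := by
  obtain ⟨L, hL, e, hs⟩ := h
  have hpos : ∀ i, 0 < L.get i := fun i => mu.parts_pos (by rw [← hL]; exact L.get_mem i)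
  have hrank := hs.rank_eq
  rw [Matrix.rank_reindex] at hrank
  have h1 := LinearMap.finrank_range_add_finrank_ker M.mulVecLin
  have h2 := LinearMap.finrank_range_add_finrank_ker
    (Matrix.blockDiagonal' fun i => jordanBlock K (L.get i)).mulVecLin
  rw [finrank_ker_blockDiagonal'_jordanBlock hpos, Module.finrank_fintype_fun_eq_card,
    Fintype.card_congr e, ← Module.finrank_fintype_fun_eq_card K] at h2
  rw [← hL, Multiset.coe_card]
  rw [Matrix.rank, Matrix.rank] at hrank
  omega

theorem hasJordanPartition_toMatrix {K V : Type*} [Field K] [AddCommGroup V] [Module K V] {N : ℕ}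
    (b : Module.Basis (Fin N) K V) (T : Module.End K V) (mu : Nat.Partition N) (L : List ℕ)
    (hL : (↑L : Multiset ℕ) = mu.parts) (w : Fin L.length → V)
    (hw : ∀ i, (T ^ L.get i) (w i) = 0)
    (hspan : ∀ S : Submodule K V, (∀ i, w i ∈ S) → (∀ v ∈ S, T v ∈ S) → S = ⊤) :
    HasJordanPartition (LinearMap.toMatrix b b T) mu := by
  have hcard : Fintype.card ((i : Fin L.length) × Fin (L.get i)) = N := by
    simp only [Fintype.card_sigma, Fintype.card_fin]
    rw [← mu.parts_sum, ← hL, Multiset.sum_coe]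
    simp
  let c : ((i : Fin L.length) × Fin (L.get i)) → V := fun s =>
    (T ^ (L.get s.1 - 1 - s.2)) (w s.1)
  have hc : ∀ i k, (T ^ k) (w i) ∈ Submodule.span K (Set.range c) := by
    intro i k
    by_cases hk : k < L.get i
    · refine Submodule.subset_span ⟨⟨i, ⟨L.get i - 1 - k, by omega⟩⟩, ?_⟩
      change (T ^ (L.get i - 1 - (L.get i - 1 - k))) (w i) = _
      congr 2
      omega
    · obtain ⟨j, rfl⟩ := Nat.exists_eq_add_of_le (not_lt.1 hk)
      rw [add_comm, pow_add, Module.End.mul_apply, hw, map_zero]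
      exact Submodule.zero_mem _
  have htop : Submodule.span K (Set.range c) = ⊤ := by
    refine hspan _ (fun i => by simpa using hc i 0) fun v hv => ?_
    have hle : Submodule.span K (Set.range c) ≤ (Submodule.span K (Set.range c)).comap T := by
      rw [Submodule.span_le]
      rintro _ ⟨s, rfl⟩
      have := hc s.1 (L.get s.1 - 1 - s.2 + 1)
      rwa [pow_succ', Module.End.mul_apply] at this
    exact hle hv
  let B := basisOfTopLeSpanOfCardEqFinrank c htop.ge
    (by rw [hcard, Module.finrank_eq_card_basis b, Fintype.card_fin])
  have hB : ∀ s, B s = c s := fun s => by simp [B]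
  let e : ((i : Fin L.length) × Fin (L.get i)) ≃ Fin N := Fintype.equivFinOfCardEq hcard
  let B' := B.reindex e
  have hmat : LinearMap.toMatrix B B T =
      Matrix.blockDiagonal' fun i => jordanBlock K (L.get i) := by
    have hT : ∀ s, T (B s) = if h : 0 < (s.2 : ℕ) then B ⟨s.1, ⟨s.2 - 1, by omega⟩⟩ else 0 := by
      rintro ⟨i, j⟩
      rw [hB]
      change T ((T ^ (L.get i - 1 - j)) (w i)) = _
      rw [← Module.End.mul_apply, ← pow_succ']
      split_ifs with h
      · rw [hB]
        change _ = (T ^ (L.get i - 1 - (j - 1))) (w i)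
        congr 2
        simp only at h
        omega
      · rw [← hw i]
        congr 2
        simp only at h
        omega
    ext ⟨i, j⟩ ⟨i', j'⟩
    rw [LinearMap.toMatrix_apply, hT]
    by_cases hi : i = i'
    · subst hi
      rw [Matrix.blockDiagonal'_apply_eq, jordanBlock, Matrix.of_apply]
      simp only
      split_ifs with h h' h'
      · rw [Module.Basis.repr_self, Finsupp.single_apply, if_pos]
        congr 1
        ext
        simp only
        omega
      · rw [Module.Basis.repr_self, Finsupp.single_apply, if_neg]
        intro h2
        simp only [Sigma.mk.injEq, heq_eq_eq, true_and, Fin.ext_iff] at h2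
        omega
      · omega
      · simp
    · rw [Matrix.blockDiagonal'_apply_ne _ _ _ hi]
      split_ifs
      · rw [Module.Basis.repr_self, Finsupp.single_apply, if_neg]
        intro h2
        exact hi (congrArg Sigma.fst h2).symm
      · simp
  refine ⟨L, hL, e, ⟨b.toMatrix B', B'.toMatrix b, b.toMatrix_mul_toMatrix_flip B',
    B'.toMatrix_mul_toMatrix_flip b⟩, ?_⟩
  have : Matrix.reindex e e (LinearMap.toMatrix B B T) = LinearMap.toMatrix B' B' T := by
    ext i j
    simp [B', LinearMap.toMatrix_apply]
  rw [← hmat, this]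
  exact (basis_toMatrix_mul_linearMap_toMatrix_mul_basis_toMatrix b B' b B' T).symm

/-- The algebra `K[x, y] / (xⁿ, y² - b x y - c x²)`, described by its dimension `2n`, its relations
and the fact that `x` and `y` generate it. -/
theorem exists_quadratic_algebra.{u} {K : Type u} [Field K] {n : ℕ} (b c : K) :
    ∃ (A : Type u) (_ : CommRing A) (_ : Algebra K A) (x y : A),
      Module.finrank K A = 2 * n ∧ x ^ n = 0 ∧
      y ^ 2 = algebraMap K A c * x ^ 2 + algebraMap K A b * x * y ∧
      ∀ S : Submodule K A, 1 ∈ S → (∀ a ∈ S, x * a ∈ S) → (∀ a ∈ S, y * a ∈ S) → S = ⊤ := by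
  have hXn : (X ^ n : K[X]).Monic := monic_X_pow n
  let R := AdjoinRoot (X ^ n : K[X])
  let t : R := AdjoinRoot.root _
  have ht : t ^ n = 0 := by
    have := AdjoinRoot.eval₂_root (X ^ n : K[X])
    simpa using this
  let P : R[X] := X ^ 2 + (-C (algebraMap K R b * t) * X - C (algebraMap K R c * t ^ 2))
  have hdeg : (-C (algebraMap K R b * t) * X - C (algebraMap K R c * t ^ 2)).degree < 2 := by
    apply lt_of_le_of_lt (b := 1)
    · compute_degree
    · norm_num
  have hP : P.Monic := monic_X_pow_add hdeg
  let A := AdjoinRoot P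
  let x : A := algebraMap R A t
  let y : A := AdjoinRoot.root P
  refine ⟨A, inferInstance, inferInstance, x, y, ?_, ?_, ?_, ?_⟩
  · rcases subsingleton_or_nontrivial R with hR | hR
    · have hn : n = 0 := by
        have := Module.finrank_zero_of_subsingleton (R := K) (M := R)
        rw [(AdjoinRoot.powerBasis' hXn).finrank] at this
        simpa using this
      have : Subsingleton A := (AdjoinRoot.mk_surjective (g := P)).subsingleton
      rw [Module.finrank_zero_of_subsingleton (R := K) (M := A)]
      omega
    · have := Module.Free.of_basis (AdjoinRoot.powerBasis' hP).basis
      have := Module.Free.of_basis (AdjoinRoot.powerBasis' hXn).basis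
      have h1 : Module.finrank R A = 2 := by
        rw [(AdjoinRoot.powerBasis' hP).finrank, AdjoinRoot.powerBasis'_dim]
        exact natDegree_eq_of_degree_eq_some (by
          rw [degree_add_eq_left_of_degree_lt (by simpa using hdeg), degree_X_pow])
      have h2 : Module.finrank K R = n := by
        rw [(AdjoinRoot.powerBasis' hXn).finrank, AdjoinRoot.powerBasis'_dim, natDegree_X_pow]
      rw [← Module.finrank_mul_finrank K R A, h1, h2, mul_comm]
  · change algebraMap R A t ^ n = 0
    rw [← map_pow, ht, map_zero]
  · have := AdjoinRoot.eval₂_root P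
    simp only [P, eval₂_add, eval₂_sub, eval₂_neg, eval₂_mul, eval₂_pow, eval₂_X, eval₂_C,
      map_mul, map_pow] at this
    change y ^ 2 + (-(algebraMap K A b * x) * y - algebraMap K A c * x ^ 2) = 0 at this
    linear_combination this
  · intro S h1 hx hy
    have hyk : ∀ k : ℕ, ∀ a ∈ S, y ^ k * a ∈ S := by
      intro k
      induction k with
      | zero => simp
      | succ k ih => exact fun a ha => by rw [pow_succ', mul_assoc]; exact hy _ (ih a ha)
    have hxk : ∀ k : ℕ, ∀ a ∈ S, x ^ k * a ∈ S := by
      intro k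
      induction k with
      | zero => simp
      | succ k ih => exact fun a ha => by rw [pow_succ', mul_assoc]; exact hx _ (ih a ha)
    have hR : ∀ r : R, algebraMap R A r ∈ S := by
      intro r
      induction r using AdjoinRoot.induction_on with
      | ih p =>
        induction p using Polynomial.induction_on' with
        | add p q hp hq =>
          rw [map_add, map_add]
          exact S.add_mem hp hq
        | monomial k a =>
          have : algebraMap R A (AdjoinRoot.mk (X ^ n) (monomial k a)) = a • (x ^ k * 1) := by
            rw [← C_mul_X_pow_eq_monomial, map_mul, map_mul, map_pow, map_pow, mul_one,
              Algebra.smul_def]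
            rfl
          rw [this]
          exact S.smul_mem _ (hxk k 1 h1)
    rw [eq_top_iff]
    rintro a -
    induction a using AdjoinRoot.induction_on with
    | ih p =>
      induction p using Polynomial.induction_on' with
      | add p q hp hq =>
        rw [map_add]
        exact S.add_mem hp hq
      | monomial k a =>
        rw [← C_mul_X_pow_eq_monomial, map_mul, map_pow, mul_comm]
        exact hyk k _ (hR a)

theorem exists_commuting_of_lucasU_ne_zero {K : Type*} [Field K] {n : ℕ} (hn : 2 ≤ n)
    {lam mu : Nat.Partition (2 * n)} (hlam : lam.parts = {n, n}) (hmu : mu.parts = {n + 1, n - 1})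
    {b c : K} (hc : c ≠ 0) (hu : lucasU b c n ≠ 0) :
    ∃ X Y : Matrix (Fin (2 * n)) (Fin (2 * n)) K,
      HasJordanPartition X lam ∧ HasJordanPartition Y mu ∧ Commute X Y := by
  obtain ⟨A, _, _, x, y, hA, hx, hy, hgen⟩ := exists_quadratic_algebra (n := n) b c
  have : FiniteDimensional K A := Module.finite_of_finrank_pos (by omega)
  let B : Module.Basis (Fin (2 * n)) K A := Module.finBasisOfFinrankEq K A hA
  have hlmul : ∀ (a : A) (k : ℕ) (z : A), ((LinearMap.mulLeft K a) ^ k) z = a ^ k * z := by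
    intro a k z
    rw [LinearMap.pow_mulLeft, LinearMap.mulLeft_apply]
  have hpow : ∀ k, y ^ (k + 1) = algebraMap K A (lucasU b c (k + 1)) * x ^ k * y +
      algebraMap K A (c * lucasU b c k) * x ^ (k + 1) := by
    intro k
    rw [pow_succ_eq_lucasU hy k, map_mul, map_lucasU, map_lucasU]
  obtain ⟨k, rfl⟩ : ∃ k, n = k + 2 := ⟨n - 2, by omega⟩
  have hyn : y ^ (k + 2) = algebraMap K A (lucasU b c (k + 2)) * x ^ (k + 1) * y := by
    rw [hpow (k + 1), hx, mul_zero, add_zero]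
  have hyn' : y ^ (k + 3) = 0 := by
    rw [pow_succ, hyn]
    linear_combination (algebraMap K A (lucasU b c (k + 2)) * x ^ (k + 1)) * hy +
      (algebraMap K A (lucasU b c (k + 2)) * (algebraMap K A c * x + algebraMap K A b * y)) * hx
  let s : K := lucasU b c (k + 1) / lucasU b c (k + 2)
  have hs : algebraMap K A s * algebraMap K A (lucasU b c (k + 2)) =
      algebraMap K A (lucasU b c (k + 1)) := by
    rw [← map_mul, div_mul_cancel₀ _ hu]
  have hw : y ^ (k + 1) * (x - algebraMap K A s * y) = 0 := by
    rw [mul_sub, mul_left_comm, ← pow_succ, hyn, hpow k]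
    linear_combination (-x ^ (k + 1) * y) * hs + algebraMap K A (c * lucasU b c k) * hx
  have hc' : algebraMap K A c⁻¹ * algebraMap K A c = 1 := by
    rw [← map_mul, inv_mul_cancel₀ hc, map_one]
  refine ⟨LinearMap.toMatrix B B (LinearMap.mulLeft K x),
    LinearMap.toMatrix B B (LinearMap.mulLeft K y), ?_, ?_, ?_⟩
  · refine hasJordanPartition_toMatrix B _ lam [k + 2, k + 2] hlam.symm ![1, y] ?_ ?_
    · intro i
      fin_cases i <;> simp [hx]
    · intro S hS hxS
      have h1 : (1 : A) ∈ S := hS 0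
      have hyS : y ∈ S := hS 1
      have htop : S ⊓ S.comap (LinearMap.mulLeft K y) = ⊤ := by
        refine hgen _ ⟨h1, by simpa using hyS⟩ ?_ ?_
        · rintro a ⟨ha, ha'⟩
          refine ⟨hxS a ha, ?_⟩
          simpa [mul_left_comm y x a] using hxS _ ha'
        · rintro a ⟨ha, ha'⟩
          refine ⟨ha', ?_⟩
          have h2 : y * (y * a) = c • (x * (x * a)) + b • (x * (y * a)) := by
            rw [Algebra.smul_def, Algebra.smul_def]
            linear_combination a * hy
          change y * (y * a) ∈ S
          rw [h2]
          exact S.add_mem (S.smul_mem _ (hxS _ (hxS _ ha))) (S.smul_mem _ (hxS _ ha'))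
      exact top_le_iff.1 (htop ▸ inf_le_left)
  · refine hasJordanPartition_toMatrix B _ mu [k + 2 + 1, k + 2 - 1] hmu.symm
      ![1, x - algebraMap K A s * y] ?_ ?_
    · intro i
      fin_cases i
      · simp [hyn']
      · simpa [hlmul] using hw
    · intro S hS hyS
      have h1 : (1 : A) ∈ S := hS 0
      have hwS : x - algebraMap K A s * y ∈ S := hS 1
      have hxS : x ∈ S := by
        have h2 : x = (x - algebraMap K A s * y) + s • (y * 1) := by
          rw [Algebra.smul_def]
          ring
        rw [h2]
        exact S.add_mem hwS (S.smul_mem _ (hyS _ h1))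
      have htop : S ⊓ S.comap (LinearMap.mulLeft K x) = ⊤ := by
        refine hgen _ ⟨h1, by simpa using hxS⟩ ?_ ?_
        · rintro a ⟨ha, ha'⟩
          refine ⟨ha', ?_⟩
          have h2 : x * (x * a) = c⁻¹ • (y * (y * a) - b • (y * (x * a))) := by
            rw [Algebra.smul_def, Algebra.smul_def]
            linear_combination (-algebraMap K A c⁻¹ * a) * hy - x ^ 2 * a * hc'
          change x * (x * a) ∈ S
          rw [h2]
          exact S.smul_mem _ (S.sub_mem (hyS _ (hyS _ ha)) (S.smul_mem _ (hyS _ ha')))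
        · rintro a ⟨ha, ha'⟩
          refine ⟨hyS a ha, ?_⟩
          simpa [mul_left_comm x y a] using hyS _ ha'
      exact top_le_iff.1 (htop ▸ inf_le_left)
  · change _ * _ = _ * _
    rw [← LinearMap.toMatrix_mul, ← LinearMap.toMatrix_mul]
    congr 1
    ext z
    simp [mul_left_comm]

open scoped IsMulCommutative in
theorem exists_lucasU_ne_zero_of_commute {K : Type*} [Field K] {n : ℕ} (hn : 3 ≤ n)
    {lam mu : Nat.Partition (2 * n)} (hlam : lam.parts = {n, n}) (hmu : mu.parts = {n + 1, n - 1})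
    {X Y : Matrix (Fin (2 * n)) (Fin (2 * n)) K} (hX : HasJordanPartition X lam)
    (hY : HasJordanPartition Y mu) (h : Commute X Y) :
    ∃ b c : K, c ≠ 0 ∧ lucasU b c n ≠ 0 := by
  let T := Matrix.toLinAlgEquiv' (R := K) (n := Fin (2 * n))
  have hcomm : ∀ a ∈ ({T X, T Y} : Set (Module.End K (Fin (2 * n) → K))),
      ∀ b ∈ ({T X, T Y} : Set (Module.End K (Fin (2 * n) → K))), a * b = b * a := by
    have h' : T X * T Y = T Y * T X := by rw [← map_mul, h.eq, map_mul]
    rintro _ (rfl | rfl) _ (rfl | rfl)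
    exacts [rfl, h', h'.symm, rfl]
  have := Algebra.isMulCommutative_adjoin K hcomm
  let x : Algebra.adjoin K {T X, T Y} := ⟨T X, Algebra.subset_adjoin (.inl rfl)⟩
  let y : Algebra.adjoin K {T X, T Y} := ⟨T Y, Algebra.subset_adjoin (.inr rfl)⟩
  have hpx : ∀ k, x ^ k = 0 ↔ X ^ k = 0 := by
    intro k
    rw [← Subtype.coe_inj, SubmonoidClass.coe_pow, ← EmbeddingLike.map_eq_zero_iff (f := T),
      map_pow]
    rfl
  have hpy : ∀ k, y ^ k = 0 ↔ Y ^ k = 0 := by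
    intro k
    rw [← Subtype.coe_inj, SubmonoidClass.coe_pow, ← EmbeddingLike.map_eq_zero_iff (f := T),
      map_pow]
    rfl
  refine exists_lucasU_ne_zero_of_commuting (V := Fin (2 * n) → K) hn (x := x) (y := y) (by simp)
    ?_ ?_ ⟨n + 1, ?_⟩ ?_ ?_
  · rw [hpx, hX.pow_eq_zero_iff, hlam]
    simp
  · rw [ne_eq, hpy, hY.pow_eq_zero_iff, hmu]
    simp
  · rw [hpy, hY.pow_eq_zero_iff, hmu]
    simp
    omega
  · have := hX.finrank_ker
    rw [hlam] at this
    exact this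
  · have := hY.finrank_ker
    rw [hmu] at this
    exact this

/-- Let `p` be a prime, `r ≥ 1`, `n ≥ 2`, and set `e = 1` if `p = 2` and
`e = 2` otherwise.  Then over the field `F_{p^r}` the nilpotent similarity
classes `N(n,n)` and `N(n+1,n-1)` commute if and only if
`p (p^{2r} - 1) / e` does not divide `n`. -/
theorem stmt17 {K : Type*} [Field K] [Fintype K] (p r n : ℕ)
    (hp : p.Prime) (hr : 1 ≤ r) (hn : 2 ≤ n) (hK : Fintype.card K = p ^ r)
    (lam mu : Nat.Partition (2 * n))
    (hlam : lam.parts = {n, n}) (hmu : mu.parts = {n + 1, n - 1}) :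
    (∃ X Y : Matrix (Fin (2 * n)) (Fin (2 * n)) K,
        HasJordanPartition X lam ∧ HasJordanPartition Y mu ∧ Commute X Y) ↔
      ¬ (p * (p ^ (2 * r) - 1) / (if p = 2 then 1 else 2) ∣ n) := by
  have hchar : CharP K p := by
    have : Fact p.Prime := ⟨hp⟩
    exact charP_of_card_eq_prime_pow hK
  rw [exponent_dvd_iff hp hr, ← hK]
  constructor
  · rintro ⟨X, Y, hX, hY, hXY⟩ ⟨h1, h2, h3⟩
    have hn3 : 3 ≤ n := by
      have := Nat.le_of_dvd (by omega) h3
      have : 1 < Fintype.card K := Fintype.one_lt_card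
      omega
    obtain ⟨b, c, hc, hu⟩ := exists_lucasU_ne_zero_of_commute hn3 hlam hmu hX hY hXY
    exact hu (lucasU_eq_zero h1 h2 h3 b c hc)
  · intro h
    obtain ⟨b, c, hc, hu⟩ := exists_lucasU_ne_zero h
    exact exists_commuting_of_lucasU_ne_zero hn hlam hmu hc hu
end
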